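/- arXiv:1909.02546 — 2 statements merged into one kernel-verified Lean document; each statement's English description precedes it below -/
import Mathlib

section
/- Let r > 0, let W be a standard Brownian motion, and let X(t) = e^{−rt} W( (e^{2rt} − 1)/(2r) ) be the Ornstein–Uhlenbeck process with mean-reversion rate r started at 0. For T > 0 and θ > 0, set η = √(r² + θ²) and X̄ = T^{−1} ∫_0^T X(u) du. Then E[ exp( −(θ²/2) ∫_0^T (X(u) − X̄)² du ) ] = √T e^{rT/2} · { (θ²/η⁴) [ 2r (cosh(ηT) − 1) + η sinh(ηT) ] + (r² T / η³) [ η cosh(ηT) + r sinh(ηT) ] }^{−1/2}. -/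
open MeasureTheory ProbabilityTheory Filter

/-- `W` is a standard Brownian motion under `P`: it is measurable in `ω` for each time,
has continuous paths on `[0,∞)`, starts at `0`, and every finite linear combination
`∑ i, c i * W (t i)` with times `t i ≥ 0` is a centered Gaussian with variance
`∑ i, ∑ j, c i * c j * min (t i) (t j)` (i.e. `W` is a centered Gaussian process with
covariance `Cov(W s, W t) = min s t`). -/
def IsStdBM {Ω : Type*} [MeasurableSpace Ω] (P : Measure Ω) (W : ℝ → Ω → ℝ) : Prop :=
  (∀ t : ℝ, Measurable (W t)) ∧
  (∀ ω, ContinuousOn (fun t => W t ω) (Set.Ici 0)) ∧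
  (∀ ω, W 0 ω = 0) ∧
  ∀ (n : ℕ) (t : Fin n → ℝ) (c : Fin n → ℝ), (∀ i, 0 ≤ t i) →
    P.map (fun ω => ∑ i, c i * W (t i) ω) =
      gaussianReal 0 (∑ i, ∑ j, c i * c j * min (t i) (t j)).toNNReal

section

open scoped NNReal ENNReal Topology

/-- `X` is the Ornstein–Uhlenbeck process driven by `W` through its time-change representation. -/
def IsOU {Ω : Type*} (r : ℝ) (W X : ℝ → Ω → ℝ) : Prop :=
  ∀ t ω, X t ω = Real.exp (-r * t) * W ((Real.exp (2 * r * t) - 1) / (2 * r)) ω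

lemma IsOU.innovation_eq {Ω : Type*} {r : ℝ} {W X : ℝ → Ω → ℝ} (hX : IsOU r W X)
    (t h : ℝ) (ω : Ω) :
    X (t + h) ω - Real.exp (-(r * h)) * X t ω =
      Real.exp (-r * (t + h)) * (W ((Real.exp (2 * r * (t + h)) - 1) / (2 * r)) ω -
        W ((Real.exp (2 * r * t) - 1) / (2 * r)) ω) := by
  rw [hX, hX, ← mul_assoc, ← Real.exp_add, show -(r * h) + -r * t = -r * (t + h) by ring]
  ring

variable {Ω : Type*} [MeasurableSpace Ω] {P : Measure Ω}

lemma IsStdBM.isGaussianProcess {W : ℝ → Ω → ℝ} (hW : IsStdBM P W) :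
    IsGaussianProcess (fun (t : ℝ≥0) => W t) P where
  hasGaussianLaw I := by
    obtain ⟨hm, -, -, hlaw⟩ := hW
    refine ⟨isGaussian_of_isGaussian_map fun L => ?_⟩
    have hmI : Measurable fun ω => I.restrict fun t : ℝ≥0 => W t ω :=
      measurable_pi_lambda _ fun i => hm _
    rw [Measure.map_map (by fun_prop) hmI]
    have key := hlaw (Fintype.card I) (fun i => ((Fintype.equivFin I).symm i : ℝ≥0))
      (fun i => L (Pi.single ((Fintype.equivFin I).symm i) 1)) (fun i => NNReal.coe_nonneg _)
    have heq : (L ∘ fun ω => I.restrict fun t : ℝ≥0 => W t ω) =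
        fun ω => ∑ i : Fin (Fintype.card I), L (Pi.single ((Fintype.equivFin I).symm i) 1) *
          W ((Fintype.equivFin I).symm i : ℝ≥0) ω := by
      ext ω
      rw [(Fintype.equivFin I).symm.sum_comp
        (fun i : I => L (Pi.single i 1) * W (i : ℝ≥0) ω), Function.comp_apply]
      conv_lhs => rw [← Finset.univ_sum_single (I.restrict fun t : ℝ≥0 => W t ω), map_sum]
      refine Finset.sum_congr rfl fun i _ => ?_
      rw [mul_comm, ← smul_eq_mul, ← map_smul, ← Pi.single_smul]
      simp
    rw [heq, key]
    infer_instance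

lemma IsStdBM.isPreBrownianReal {W : ℝ → Ω → ℝ} (hW : IsStdBM P W) :
    IsPreBrownianReal (fun (t : ℝ≥0) => W t) P := by
  have hG := hW.isGaussianProcess
  have := hG.isProbabilityMeasure
  obtain ⟨hm, -, -, hlaw⟩ := hW
  have hlaw1 (t : ℝ≥0) : HasLaw (W t) (gaussianReal 0 t) P :=
    ⟨(hm _).aemeasurable, by simpa using hlaw 1 (fun _ => t) (fun _ => 1) (by simp)⟩
  have hlaw2 (s t : ℝ≥0) (hst : s ≤ t) :
      HasLaw (W s + W t) (gaussianReal 0 (3 * s + t)) P := by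
    refine ⟨((hm _).add (hm _)).aemeasurable, ?_⟩
    have h := hlaw 2 ![s, t] (fun _ => 1) (by simp [Fin.forall_fin_two])
    have hst' : (s : ℝ) ≤ t := hst
    simp only [Fin.sum_univ_two, one_mul, Matrix.cons_val_zero, Matrix.cons_val_one,
      min_self, min_eq_left hst', min_eq_right hst'] at h
    have hvar : ((s : ℝ) + s + (s + t)).toNNReal = 3 * s + t := by
      ext
      rw [Real.coe_toNNReal _ (by positivity)]
      push_cast
      ring
    rwa [hvar] at h
  refine hG.isPreBrownianReal_of_covariance (fun t => ?_) (fun s t hst => ?_)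
  · rw [(hlaw1 t).integral_eq, integral_id_gaussianReal]
  · have hv := variance_add (hG.hasGaussianLaw_eval s).memLp_two
      (hG.hasGaussianLaw_eval t).memLp_two
    rw [(hlaw2 s t hst).variance_eq, (hlaw1 s).variance_eq, (hlaw1 t).variance_eq] at hv
    simp only [variance_id_gaussianReal] at hv
    push_cast at hv
    linarith

/-- Expectation of a Gaussian function under a centered Gaussian law. -/
lemma lintegral_exp_quadratic_gaussianReal {v : ℝ≥0} (hv : v ≠ 0) (a β : ℝ)
    (hav : 0 < 1 + a * v) :
    ∫⁻ y, ENNReal.ofReal (Real.exp (-(a * y ^ 2) / 2 + β * y)) ∂gaussianReal 0 v =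
      ENNReal.ofReal ((√(1 + a * v))⁻¹ * Real.exp (β ^ 2 * v / (2 * (1 + a * v)))) := by
  have hv' : (0 : ℝ) < v := by positivity
  have hav' : 0 < 1 + v * a := by rwa [mul_comm]
  obtain ⟨w, hw⟩ : ∃ w : ℝ≥0, (w : ℝ) = v / (1 + a * v) := ⟨⟨_, by positivity⟩, rfl⟩
  have hw0 : w ≠ 0 := by
    rintro rfl
    have : (0 : ℝ) < v / (1 + a * v) := by positivity
    simp [← hw] at this
  rw [gaussianReal_of_var_ne_zero _ hv,
    lintegral_withDensity_eq_lintegral_mul _ (measurable_gaussianPDF _ _) (by fun_prop)]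
  have hpt : ∀ y, (gaussianPDF 0 v *
      fun y => ENNReal.ofReal (Real.exp (-(a * y ^ 2) / 2 + β * y))) y =
      ENNReal.ofReal ((√(1 + a * v))⁻¹ * Real.exp (β ^ 2 * v / (2 * (1 + a * v)))) *
        gaussianPDF (β * w) w y := by
    intro y
    rw [Pi.mul_apply, gaussianPDF, gaussianPDF, ← ENNReal.ofReal_mul (gaussianPDFReal_nonneg _ _ _),
      ← ENNReal.ofReal_mul (by positivity)]
    congr 1
    rw [gaussianPDFReal, gaussianPDFReal, hw]
    have hs : √(2 * Real.pi * (v / (1 + a * v))) = √(2 * Real.pi * v) / √(1 + a * v) := by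
      rw [← Real.sqrt_div (by positivity), mul_div_assoc]
    rw [hs, mul_assoc, ← Real.exp_add]
    have hexp : -(y - 0) ^ 2 / (2 * v) + (-(a * y ^ 2) / 2 + β * y) =
        β ^ 2 * v / (2 * (1 + a * v)) +
          -(y - β * (v / (1 + a * v))) ^ 2 / (2 * (v / (1 + a * v))) := by
      field_simp
      ring
    rw [hexp, Real.exp_add]
    have : √(1 + v * a) ≠ 0 := by positivity
    rw [mul_comm a]
    have : √(2 * Real.pi * v) ≠ 0 := by positivity
    field_simp
  simp_rw [hpt]
  rw [lintegral_const_mul _ (measurable_gaussianPDF _ _), lintegral_gaussianPDF_eq_one _ hw0,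
    mul_one]

/-- The transition variance of the Ornstein–Uhlenbeck process over a time step `h`. -/
noncomputable def ouVar (r h : ℝ) : ℝ := (1 - Real.exp (-(2 * r * h))) / (2 * r)

lemma ouVar_pos {r h : ℝ} (hr : 0 < r) (hh : 0 < h) : 0 < ouVar r h := by
  have : Real.exp (-(2 * r * h)) < 1 := Real.exp_lt_one_iff.2 (by nlinarith [mul_pos hr hh])
  exact div_pos (by linarith) (by positivity)

lemma exp_sub_one_div_nonneg {r t : ℝ} (hr : 0 < r) (ht : 0 ≤ t) :
    0 ≤ (Real.exp (2 * r * t) - 1) / (2 * r) := by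
  have : 1 ≤ Real.exp (2 * r * t) := Real.one_le_exp (by positivity)
  exact div_nonneg (by linarith) (by positivity)

lemma IsOU.measurable {r : ℝ} {W X : ℝ → Ω → ℝ} (hX : IsOU r W X)
    (hW : IsStdBM P W) (t : ℝ) : Measurable (X t) := by
  rw [show X t = _ from funext (hX t)]
  exact (hW.1 _).const_mul _

lemma IsOU.apply_zero {r : ℝ} {W X : ℝ → Ω → ℝ} (hX : IsOU r W X)
    (hW : IsStdBM P W) (ω : Ω) : X 0 ω = 0 := by
  simp [hX 0 ω, hW.2.2.1 ω]

lemma IsOU.continuousOn {r : ℝ} (hr : 0 < r) {W X : ℝ → Ω → ℝ}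
    (hX : IsOU r W X) (hW : IsStdBM P W) (ω : Ω) :
    ContinuousOn (fun t => X t ω) (Set.Ici 0) := by
  rw [show (fun t => X t ω) = _ from funext fun t => hX t ω]
  refine ContinuousOn.mul (by fun_prop) ?_
  exact (hW.2.1 ω).comp (by fun_prop) fun t ht => exp_sub_one_div_nonneg hr ht

lemma IsOU.hasLaw_innovation {r : ℝ} (hr : 0 < r) {W X : ℝ → Ω → ℝ}
    (hX : IsOU r W X) (hW : IsStdBM P W) {t h : ℝ} (ht : 0 ≤ t) (hh : 0 ≤ h) :
    HasLaw (fun ω => X (t + h) ω - Real.exp (-(r * h)) * X t ω)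
      (gaussianReal 0 (ouVar r h).toNNReal) P := by
  have hle : Real.exp (2 * r * t) ≤ Real.exp (2 * r * (t + h)) :=
    Real.exp_le_exp.2 (by nlinarith [mul_nonneg hr.le hh])
  obtain ⟨s₁, hs₁⟩ : ∃ s : ℝ≥0, (s : ℝ) = (Real.exp (2 * r * (t + h)) - 1) / (2 * r) :=
    ⟨⟨_, exp_sub_one_div_nonneg hr (add_nonneg ht hh)⟩, rfl⟩
  obtain ⟨s₀, hs₀⟩ : ∃ s : ℝ≥0, (s : ℝ) = (Real.exp (2 * r * t) - 1) / (2 * r) :=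
    ⟨⟨_, exp_sub_one_div_nonneg hr ht⟩, rfl⟩
  have hlaw := gaussianReal_const_mul (hW.isPreBrownianReal.hasLaw_sub s₁ s₀)
    (Real.exp (-r * (t + h)))
  have hd : dist (s₁ : ℝ) s₀ =
      (Real.exp (2 * r * (t + h)) - Real.exp (2 * r * t)) / (2 * r) := by
    rw [hs₁, hs₀, Real.dist_eq, ← sub_div,
      abs_of_nonneg (div_nonneg (by linarith) (by positivity))]
    ring
  have hvar : NNReal.mk (Real.exp (-r * (t + h)) ^ 2) (sq_nonneg _) * nndist (s₁ : ℝ) s₀ =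
      (ouVar r h).toNNReal := by
    have hs : ouVar r h = Real.exp (-r * (t + h)) ^ 2 * dist (s₁ : ℝ) s₀ := by
      rw [hd, ouVar, ← mul_div_assoc, mul_sub, ← Real.exp_nat_mul, ← Real.exp_add,
        ← Real.exp_add, ← Real.exp_zero]
      push_cast
      ring_nf
    ext
    rw [hs, Real.coe_toNNReal _ (by positivity)]
    simp
  rw [mul_zero] at hlaw
  simp_rw [hX.innovation_eq t h, ← hs₁, ← hs₀]
  convert hlaw using 2
  · rfl
  · exact hvar.symm

lemma IsOU.indepFun_innovation {r : ℝ} (hr : 0 < r) {W X : ℝ → Ω → ℝ}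
    (hX : IsOU r W X) (hW : IsStdBM P W) {t h : ℝ} (ht : 0 ≤ t) (hh : 0 ≤ h) :
    IndepFun (fun ω => X (t + h) ω - Real.exp (-(r * h)) * X t ω)
      (fun ω (u : Set.Icc 0 t) => X u ω) P := by
  have hmono {u v : ℝ} (huv : u ≤ v) :
      (Real.exp (2 * r * u) - 1) / (2 * r) ≤ (Real.exp (2 * r * v) - 1) / (2 * r) := by
    gcongr
  let S (u : ℝ) (hu : 0 ≤ u) : ℝ≥0 := ⟨_, exp_sub_one_div_nonneg hr hu⟩
  have hS {u v : ℝ} (hu : 0 ≤ u) (hv : 0 ≤ v) (huv : u ≤ v) : S u hu ≤ S v hv := hmono huv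
  have key := hW.isPreBrownianReal.indepFun_shift (S t ht)
  have hth := add_nonneg ht hh
  have hadd : S t ht + (S (t + h) hth - S t ht) = S (t + h) hth :=
    add_tsub_cancel_of_le (hS ht hth (by linarith))
  have := key.comp
    (φ := fun p => Real.exp (-r * (t + h)) * p (S (t + h) hth - S t ht))
    (ψ := fun p (u : Set.Icc 0 t) =>
      Real.exp (-r * u) * p ⟨S u u.2.1, hS u.2.1 ht u.2.2⟩) (by fun_prop) (by fun_prop)
  convert this using 1
  · ext ω
    simp only [Function.comp_apply]
    rw [hX.innovation_eq t h, hadd]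
    rfl
  · ext ω u
    rw [hX]
    rfl

/-- Telescoping of Feynman–Kac weights along an autoregressive chain: if `G k` times the one-step
expectation of `v (k + 1)` equals `v k`, then the weighted expectation of `v n` is that of `v 0`. -/
lemma lintegral_prod_weights_mul [IsProbabilityMeasure P] {x : ℕ → Ω → ℝ} {ν : Measure ℝ} {ρ : ℝ}
    [SFinite ν]
    (hx : ∀ k, Measurable (x k))
    (hlaw : ∀ k, HasLaw (fun ω => x (k + 1) ω - ρ * x k ω) ν P)
    (hind : ∀ k, IndepFun (fun ω => x (k + 1) ω - ρ * x k ω)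
      (fun ω (j : Set.Iic k) => x j ω) P)
    {G v : ℕ → ℝ → ℝ≥0∞} (hG : ∀ k, Measurable (G k)) (hv : ∀ k, Measurable (v k)) (n : ℕ)
    (hstep : ∀ k < n, ∀ y, G k y * ∫⁻ z, v (k + 1) (ρ * y + z) ∂ν = v k y) :
    ∫⁻ ω, (∏ j ∈ Finset.range n, G j (x j ω)) * v n (x n ω) ∂P = ∫⁻ ω, v 0 (x 0 ω) ∂P := by
  induction n with
  | zero => simp
  | succ n ih =>
    rw [← ih fun k hk => hstep k (by omega)]
    let A : (Set.Iic n → ℝ) → ℝ≥0∞ :=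
      fun p => ∏ j : Fin (n + 1), G j (p ⟨j, by simpa using Nat.lt_succ_iff.1 j.2⟩)
    have hA : Measurable A :=
      Finset.measurable_prod _ fun j _ => (hG _).comp (measurable_pi_apply _)
    let p : Ω → Set.Iic n → ℝ := fun ω j => x j ω
    have hp : Measurable p := measurable_pi_lambda _ fun j => hx _
    let f : (Set.Iic n → ℝ) × ℝ → ℝ≥0∞ := fun q =>
      A q.1 * v (n + 1) (ρ * q.1 ⟨n, by simp⟩ + q.2)
    have hf : Measurable f := by
      refine (hA.comp measurable_fst).mul ((hv _).comp ?_)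
      exact (((measurable_pi_apply _).comp measurable_fst).const_mul _).add measurable_snd
    have hmap := (indepFun_iff_map_prod_eq_prod_map_map hp.aemeasurable
      (hlaw n).aemeasurable).1 (hind n).symm
    rw [(hlaw n).map_eq] at hmap
    have hAp (ω : Ω) : A (p ω) = ∏ j ∈ Finset.range (n + 1), G j (x j ω) :=
      Fin.prod_univ_eq_prod_range (fun j => G j (x j ω)) (n + 1)
    have hmξ : Measurable fun ω => x (n + 1) ω - ρ * x n ω := (hx _).sub ((hx _).const_mul _)
    calc ∫⁻ ω, (∏ j ∈ Finset.range (n + 1), G j (x j ω)) * v (n + 1) (x (n + 1) ω) ∂P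
        = ∫⁻ ω, f (p ω, x (n + 1) ω - ρ * x n ω) ∂P := by
          refine lintegral_congr fun ω => ?_
          simp only [f, hAp, p, add_sub_cancel]
      _ = ∫⁻ q, f q ∂((P.map p).prod ν) := by
          rw [← hmap, lintegral_map hf (hp.prodMk hmξ)]
      _ = ∫⁻ ω, ∫⁻ z, f (p ω, z) ∂ν ∂P := by
          rw [lintegral_prod _ hf.aemeasurable, lintegral_map hf.lintegral_prod_right' hp]
      _ = _ := by
          refine lintegral_congr fun ω => ?_
          simp only [f]
          have hvm : Measurable fun z => v (n + 1) (ρ * p ω ⟨n, by simp⟩ + z) :=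
            (hv _).comp (measurable_const.add measurable_id)
          rw [lintegral_const_mul _ hvm, hAp,
            Finset.prod_range_succ, mul_assoc]
          congr 1
          exact hstep n (by omega) (x n ω)

/-- Weighted Riemann sums of a continuous function converge to a multiple of its integral, when the
weights are uniformly asymptotic to that multiple of the step. -/
lemma tendsto_weighted_riemannSum {f : ℝ → ℝ} {T γ : ℝ} (hT : 0 < T)
    (hf : ContinuousOn f (Set.Icc 0 T)) {φ : ℕ → ℕ → ℝ}
    (hφ : ∀ ε > 0, ∀ᶠ n : ℕ in atTop, ∀ k < n, |φ n k - γ * (T / n)| ≤ ε * (T / n)) :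
    Tendsto (fun n : ℕ => ∑ k ∈ Finset.range n, φ n k * f (k * (T / n))) atTop
      (𝓝 (γ * ∫ u in (0 : ℝ)..T, f u)) := by
  obtain ⟨M, hM⟩ := isCompact_Icc.exists_bound_of_continuousOn hf
  have hM0 : 0 ≤ M := (norm_nonneg _).trans (hM 0 (by simp [hT.le]))
  have hunif := Metric.uniformContinuousOn_iff_le.1
    (isCompact_Icc.uniformContinuousOn_of_continuous hf)
  rw [Metric.tendsto_atTop]
  intro ε' hε'
  obtain ⟨ε, hε, hlt⟩ : ∃ ε > 0, ε * (T * (M + |γ|)) < ε' := by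
    refine ⟨ε' / (T * (M + |γ|) + 1), by positivity, ?_⟩
    rw [div_mul_eq_mul_div, div_lt_iff₀ (by positivity)]
    nlinarith
  obtain ⟨δ, hδ, hfδ⟩ := hunif ε hε
  have hsmall : ∀ᶠ n : ℕ in atTop, T / n ≤ δ :=
    (tendsto_const_div_atTop_nhds_zero_nat T).eventually (ge_mem_nhds hδ)
  obtain ⟨N, hN⟩ := eventually_atTop.1 ((hφ ε hε).and (hsmall.and (eventually_gt_atTop 0)))
  refine ⟨N, fun n hn => ?_⟩
  obtain ⟨hφn, hnδ, hn0⟩ := hN n hn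
  have hn0' : (0 : ℝ) < n := by exact_mod_cast hn0
  set h := T / n with hh
  have hhpos : 0 < h := by positivity
  have hnh : n * h = T := by rw [hh]; field_simp
  have hsub (k : ℕ) (hk : k < n) : Set.Icc (k * h) ((k + 1 : ℕ) * h) ⊆ Set.Icc 0 T := by
    refine Set.Icc_subset_Icc (by positivity) ?_
    rw [← hnh]
    gcongr
    exact hk
  have hle (k : ℕ) : k * h ≤ (k + 1 : ℕ) * h := by gcongr; simp
  have hfint (k : ℕ) (hk : k < n) :
      IntervalIntegrable f volume (k * h) ((k + 1 : ℕ) * h) := by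
    refine ContinuousOn.intervalIntegrable ?_
    rw [Set.uIcc_of_le (hle k)]
    exact hf.mono (hsub k hk)
  have hsum : ∫ u in (0 : ℝ)..T, f u =
      ∑ k ∈ Finset.range n, ∫ u in (k * h)..((k + 1 : ℕ) * h), f u := by
    rw [intervalIntegral.sum_integral_adjacent_intervals (a := fun k : ℕ => k * h) hfint]
    simp [hnh]
  have hlen (k : ℕ) : ((k + 1 : ℕ) : ℝ) * h - k * h = h := by push_cast; ring
  have hstep (k : ℕ) (hk : k < n) :
      |φ n k * f (k * h) - γ * ∫ u in (k * h)..((k + 1 : ℕ) * h), f u| ≤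
        ε * (M + |γ|) * h := by
    have hk0 : (k : ℝ) * h ∈ Set.Icc 0 T := hsub k hk ⟨le_rfl, hle k⟩
    have hosc : |h * f (k * h) - ∫ u in (k * h)..((k + 1 : ℕ) * h), f u| ≤ ε * h := by
      have hconst : h * f (k * h) = ∫ _ in (k * h)..((k + 1 : ℕ) * h), f (k * h) := by
        rw [intervalIntegral.integral_const, hlen, smul_eq_mul]
      rw [hconst, ← intervalIntegral.integral_sub (by simp) (hfint k hk), ← Real.norm_eq_abs]
      refine (intervalIntegral.norm_integral_le_of_norm_le_const (C := ε) fun u hu => ?_).trans ?_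
      · rw [Set.uIoc_of_le (hle k)] at hu
        refine hfδ _ hk0 _ (hsub k hk ⟨hu.1.le, hu.2⟩) ?_
        rw [dist_comm, Real.dist_eq, abs_of_nonneg (by linarith [hu.1])]
        linarith [hu.2, hlen k]
      · rw [hlen, abs_of_pos hhpos]
    calc |φ n k * f (k * h) - γ * ∫ u in (k * h)..((k + 1 : ℕ) * h), f u|
        = |(φ n k - γ * h) * f (k * h) +
            γ * (h * f (k * h) - ∫ u in (k * h)..((k + 1 : ℕ) * h), f u)| := by ring_nf
      _ ≤ |φ n k - γ * h| * |f (k * h)| +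
            |γ| * |h * f (k * h) - ∫ u in (k * h)..((k + 1 : ℕ) * h), f u| := by
          rw [← abs_mul, ← abs_mul]
          exact abs_add_le _ _
      _ ≤ ε * h * M + |γ| * (ε * h) := by
          gcongr
          · exact hφn k hk
          · exact hM _ hk0
      _ = _ := by ring
  rw [Real.dist_eq, hsum, Finset.mul_sum, ← Finset.sum_sub_distrib]
  calc |∑ k ∈ Finset.range n, (φ n k * f (k * h) -
          γ * ∫ u in (k * h)..((k + 1 : ℕ) * h), f u)|
      ≤ ∑ k ∈ Finset.range n, ε * (M + |γ|) * h :=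
        (Finset.abs_sum_le_sum_abs _ _).trans
          (Finset.sum_le_sum fun k hk => hstep k (Finset.mem_range.1 hk))
    _ = ε * (T * (M + |γ|)) := by
        rw [Finset.sum_const, Finset.card_range, nsmul_eq_mul, ← hnh]
        ring
    _ < ε' := hlt

/-- A first-order expansion in the step `h`, uniform in the parameter `τ`. -/
lemma exists_forall_abs_sub_mul_le {F F' : ℝ → ℝ → ℝ} {T γ : ℝ} (hT : 0 < T)
    (hF0 : ∀ τ ∈ Set.Icc 0 T, F τ 0 = 0)
    (hF : ∀ τ ∈ Set.Icc 0 T, ∀ h ∈ Set.Icc 0 T, HasDerivAt (F τ) (F' τ h) h)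
    (hF'0 : ∀ τ ∈ Set.Icc 0 T, F' τ 0 = γ)
    (hF' : ContinuousOn (fun p : ℝ × ℝ => F' p.1 p.2) (Set.Icc 0 T ×ˢ Set.Icc 0 T))
    {ε : ℝ} (hε : 0 < ε) :
    ∃ δ > 0, ∀ τ ∈ Set.Icc 0 T, ∀ h ∈ Set.Icc 0 δ, |F τ h - γ * h| ≤ ε * h := by
  obtain ⟨δ, hδ, hFδ⟩ := Metric.uniformContinuousOn_iff_le.1
    ((isCompact_Icc.prod isCompact_Icc).uniformContinuousOn_of_continuous hF') ε hε
  refine ⟨min δ T, lt_min hδ hT, fun τ hτ h hh => ?_⟩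
  have hsub : Set.Icc 0 h ⊆ Set.Icc 0 T :=
    Set.Icc_subset_Icc le_rfl (hh.2.trans (min_le_right _ _))
  have hmv := (convex_Icc (0 : ℝ) h).norm_image_sub_le_of_norm_hasDerivWithin_le
    (f := fun y => F τ y - γ * y) (f' := fun y => F' τ y - γ) (C := ε)
    (fun y hy => ((hF τ hτ y (hsub hy)).sub
      (by simpa using (hasDerivAt_id y).const_mul γ)).hasDerivWithinAt)
    (fun y hy => by
      rw [← hF'0 τ hτ]
      refine hFδ (τ, y) ⟨hτ, hsub hy⟩ (τ, 0) ⟨hτ, by simp [hT.le]⟩ ?_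
      rw [Prod.dist_eq, dist_self, Real.dist_eq, sub_zero, abs_of_nonneg hy.1]
      exact max_le hδ.le (hy.2.trans (hh.2.trans (min_le_left _ _))))
    (Set.left_mem_Icc.2 hh.1) (Set.right_mem_Icc.2 hh.1)
  simpa [hF0 τ hτ, abs_of_nonneg hh.1] using hmv

/-- The backward system for which `exp (-a x² / 2 + b x + c)`, in the time to maturity, solves the
Feynman–Kac equation of the Ornstein–Uhlenbeck process with potential `-θ² x² / 2 + μ x`. -/
structure IsRiccatiSolution (r θ μ : ℝ) (a b c : ℝ → ℝ) : Prop where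
  a_zero : a 0 = 0
  b_zero : b 0 = 0
  c_zero : c 0 = 0
  a_nonneg : ∀ τ, 0 ≤ τ → 0 ≤ a τ
  hasDerivAt_a : ∀ τ, HasDerivAt a (θ ^ 2 - 2 * r * a τ - a τ ^ 2) τ
  hasDerivAt_b : ∀ τ, HasDerivAt b (μ - (r + a τ) * b τ) τ
  hasDerivAt_c : ∀ τ, HasDerivAt c ((b τ ^ 2 - a τ) / 2) τ

/-- Quadratic coefficient of the weight carried by one step of the discretized process. -/
noncomputable def stepQuad (r : ℝ) (a : ℝ → ℝ) (τ h : ℝ) : ℝ :=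
  a (τ + h) - a τ * Real.exp (-(2 * r * h)) / (1 + a τ * ouVar r h)

/-- Linear coefficient of the weight carried by one step of the discretized process. -/
noncomputable def stepLin (r : ℝ) (a b : ℝ → ℝ) (τ h : ℝ) : ℝ :=
  b (τ + h) - b τ * Real.exp (-(r * h)) / (1 + a τ * ouVar r h)

/-- Constant coefficient of the weight carried by one step of the discretized process. -/
noncomputable def stepConst (r : ℝ) (a b c : ℝ → ℝ) (τ h : ℝ) : ℝ :=
  c (τ + h) - c τ - b τ ^ 2 * ouVar r h / (2 * (1 + a τ * ouVar r h)) +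
    Real.log (1 + a τ * ouVar r h) / 2

@[simp] lemma ouVar_zero (r : ℝ) : ouVar r 0 = 0 := by simp [ouVar]

lemma ouVar_nonneg {r h : ℝ} (hr : 0 < r) (hh : 0 ≤ h) : 0 ≤ ouVar r h := by
  rcases hh.eq_or_lt with rfl | hh
  · simp
  · exact (ouVar_pos hr hh).le

lemma hasDerivAt_exp_neg_mul (k h : ℝ) :
    HasDerivAt (fun h => Real.exp (-(k * h))) (-(k * Real.exp (-(k * h)))) h := by
  have hlin : HasDerivAt (fun h => -(k * h)) (-k) h := by
    simpa using (hasDerivAt_id' h).const_mul (-k)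
  exact hlin.exp.congr_deriv (by ring)

lemma hasDerivAt_ouVar {r : ℝ} (hr : 0 < r) (h : ℝ) :
    HasDerivAt (ouVar r) (Real.exp (-(2 * r * h))) h := by
  refine (((hasDerivAt_exp_neg_mul (2 * r) h).const_sub 1).div_const (2 * r)).congr_deriv ?_
  field_simp

lemma continuous_ouVar (r : ℝ) : Continuous (ouVar r) := by
  unfold ouVar
  fun_prop

namespace IsRiccatiSolution

variable {r θ μ T : ℝ} {a b c : ℝ → ℝ}

lemma continuous_a (H : IsRiccatiSolution r θ μ a b c) : Continuous a :=
  continuous_iff_continuousAt.2 fun τ => (H.hasDerivAt_a τ).continuousAt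

lemma continuous_b (H : IsRiccatiSolution r θ μ a b c) : Continuous b :=
  continuous_iff_continuousAt.2 fun τ => (H.hasDerivAt_b τ).continuousAt

lemma one_add_pos (H : IsRiccatiSolution r θ μ a b c) (hr : 0 < r) {τ h : ℝ}
    (hτ : 0 ≤ τ) (hh : 0 ≤ h) : 0 < 1 + a τ * ouVar r h := by
  have := mul_nonneg (H.a_nonneg τ hτ) (ouVar_nonneg hr hh)
  linarith

lemma stepQuad_expansion (H : IsRiccatiSolution r θ μ a b c) (hr : 0 < r) (hT : 0 < T)
    {ε : ℝ} (hε : 0 < ε) :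
    ∃ δ > 0, ∀ τ ∈ Set.Icc 0 T, ∀ h ∈ Set.Icc 0 δ,
      |stepQuad r a τ h - θ ^ 2 * h| ≤ ε * h := by
  have ha := H.continuous_a
  have hs := continuous_ouVar r
  refine exists_forall_abs_sub_mul_le (F' := fun τ h =>
    (θ ^ 2 - 2 * r * a (τ + h) - a (τ + h) ^ 2) -
      ((a τ * -(2 * r * Real.exp (-(2 * r * h)))) * (1 + a τ * ouVar r h) -
        a τ * Real.exp (-(2 * r * h)) * (a τ * Real.exp (-(2 * r * h)))) /
        (1 + a τ * ouVar r h) ^ 2) hT ?_ ?_ ?_ ?_ hε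
  · intro τ _
    simp [stepQuad]
  · intro τ hτ h hh
    have hne := (H.one_add_pos hr hτ.1 hh.1).ne'
    exact ((H.hasDerivAt_a (τ + h)).comp_const_add τ h).sub
      (((hasDerivAt_exp_neg_mul (2 * r) h).const_mul (a τ)).div
        (((hasDerivAt_ouVar hr h).const_mul (a τ)).const_add 1) hne)
  · intro τ _
    simp
    ring
  · refine ContinuousOn.sub (by fun_prop) (ContinuousOn.div (by fun_prop) (by fun_prop) ?_)
    rintro ⟨τ, h⟩ ⟨hτ, hh⟩
    exact pow_ne_zero 2 (H.one_add_pos hr hτ.1 hh.1).ne'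

lemma stepLin_expansion (H : IsRiccatiSolution r θ μ a b c) (hr : 0 < r) (hT : 0 < T)
    {ε : ℝ} (hε : 0 < ε) :
    ∃ δ > 0, ∀ τ ∈ Set.Icc 0 T, ∀ h ∈ Set.Icc 0 δ,
      |stepLin r a b τ h - μ * h| ≤ ε * h := by
  have ha := H.continuous_a
  have hb := H.continuous_b
  have hs := continuous_ouVar r
  refine exists_forall_abs_sub_mul_le (F' := fun τ h =>
    (μ - (r + a (τ + h)) * b (τ + h)) -
      ((b τ * -(r * Real.exp (-(r * h)))) * (1 + a τ * ouVar r h) -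
        b τ * Real.exp (-(r * h)) * (a τ * Real.exp (-(2 * r * h)))) /
        (1 + a τ * ouVar r h) ^ 2) hT ?_ ?_ ?_ ?_ hε
  · intro τ _
    simp [stepLin]
  · intro τ hτ h hh
    have hne := (H.one_add_pos hr hτ.1 hh.1).ne'
    exact ((H.hasDerivAt_b (τ + h)).comp_const_add τ h).sub
      (((hasDerivAt_exp_neg_mul r h).const_mul (b τ)).div
        (((hasDerivAt_ouVar hr h).const_mul (a τ)).const_add 1) hne)
  · intro τ _
    simp
    ring
  · refine ContinuousOn.sub (by fun_prop) (ContinuousOn.div (by fun_prop) (by fun_prop) ?_)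
    rintro ⟨τ, h⟩ ⟨hτ, hh⟩
    exact pow_ne_zero 2 (H.one_add_pos hr hτ.1 hh.1).ne'

lemma stepConst_expansion (H : IsRiccatiSolution r θ μ a b c) (hr : 0 < r) (hT : 0 < T)
    {ε : ℝ} (hε : 0 < ε) :
    ∃ δ > 0, ∀ τ ∈ Set.Icc 0 T, ∀ h ∈ Set.Icc 0 δ,
      |stepConst r a b c τ h - 0 * h| ≤ ε * h := by
  have ha := H.continuous_a
  have hb := H.continuous_b
  have hs := continuous_ouVar r
  refine exists_forall_abs_sub_mul_le (F' := fun τ h =>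
    (b (τ + h) ^ 2 - a (τ + h)) / 2 -
      ((b τ ^ 2 * Real.exp (-(2 * r * h))) * (2 * (1 + a τ * ouVar r h)) -
        b τ ^ 2 * ouVar r h * (2 * (a τ * Real.exp (-(2 * r * h))))) /
        (2 * (1 + a τ * ouVar r h)) ^ 2 +
      a τ * Real.exp (-(2 * r * h)) / (1 + a τ * ouVar r h) / 2) hT ?_ ?_ ?_ ?_ hε
  · intro τ _
    simp [stepConst]
  · intro τ hτ h hh
    have hne := (H.one_add_pos hr hτ.1 hh.1).ne'
    have hm := ((hasDerivAt_ouVar hr h).const_mul (a τ)).const_add 1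
    exact ((((H.hasDerivAt_c (τ + h)).comp_const_add τ h).sub_const (c τ)).sub
      (((hasDerivAt_ouVar hr h).const_mul (b τ ^ 2)).div (hm.const_mul 2)
        (mul_ne_zero two_ne_zero hne))).add ((hm.log hne).div_const 2)
  · intro τ _
    simp
    ring
  · refine ContinuousOn.add (ContinuousOn.sub (by fun_prop)
      (ContinuousOn.div (by fun_prop) (by fun_prop) ?_))
      ((ContinuousOn.div (by fun_prop) (by fun_prop) ?_).div_const 2)
    all_goals
      rintro ⟨τ, h⟩ ⟨hτ, hh⟩
      have := (H.one_add_pos hr hτ.1 hh.1).ne'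
      simpa using this

/-- One step of the discrete Feynman–Kac recursion. -/
lemma weight_mul_lintegral (H : IsRiccatiSolution r θ μ a b c) (hr : 0 < r) {τ h : ℝ}
    (hτ : 0 ≤ τ) (hh : 0 < h) (y : ℝ) :
    ENNReal.ofReal (Real.exp (-(stepQuad r a τ h * y ^ 2) / 2 + stepLin r a b τ h * y +
        stepConst r a b c τ h)) *
      ∫⁻ z, ENNReal.ofReal (Real.exp (-(a τ * (Real.exp (-(r * h)) * y + z) ^ 2) / 2 +
        b τ * (Real.exp (-(r * h)) * y + z) + c τ)) ∂gaussianReal 0 (ouVar r h).toNNReal =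
      ENNReal.ofReal (Real.exp (-(a (τ + h) * y ^ 2) / 2 + b (τ + h) * y + c (τ + h))) := by
  have hs := ouVar_pos hr hh
  have hm := H.one_add_pos hr hτ hh.le
  have hsNN : ((ouVar r h).toNNReal : ℝ) = ouVar r h := Real.coe_toNNReal _ hs.le
  set ρ := Real.exp (-(r * h)) with hρ
  have hρ2 : Real.exp (-(2 * r * h)) = ρ ^ 2 := by
    rw [hρ, ← Real.exp_nat_mul]
    push_cast
    ring_nf
  have hsplit (z : ℝ) : ENNReal.ofReal (Real.exp (-(a τ * (ρ * y + z) ^ 2) / 2 +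
        b τ * (ρ * y + z) + c τ)) =
      ENNReal.ofReal (Real.exp (-(a τ * (ρ * y) ^ 2) / 2 + b τ * (ρ * y) + c τ)) *
        ENNReal.ofReal (Real.exp (-(a τ * z ^ 2) / 2 + (b τ - a τ * (ρ * y)) * z)) := by
    rw [← ENNReal.ofReal_mul (Real.exp_nonneg _), ← Real.exp_add]
    ring_nf
  simp_rw [hsplit]
  rw [lintegral_const_mul _ (by fun_prop),
    lintegral_exp_quadratic_gaussianReal (by simpa using hs) _ _ (by rwa [hsNN]), hsNN,
    ← ENNReal.ofReal_mul (Real.exp_nonneg _), ← ENNReal.ofReal_mul (Real.exp_nonneg _)]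
  have hsqrt : (√(1 + a τ * ouVar r h))⁻¹ = Real.exp (-(Real.log (1 + a τ * ouVar r h) / 2)) := by
    rw [Real.exp_neg, Real.exp_half, Real.exp_log hm]
  rw [hsqrt, ← Real.exp_add, ← Real.exp_add, ← Real.exp_add, stepQuad, stepLin, stepConst, hρ2,
    ← hρ]
  congr 2
  have hne := hm.ne'
  field_simp
  ring

end IsRiccatiSolution

/-- Uniform expansion of step coefficients along the grid of mesh `T / n`. -/
lemma eventually_forall_abs_sub_mul_le {F : ℝ → ℝ → ℝ} {T γ : ℝ} (hT : 0 < T)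
    (hF : ∀ ε > 0, ∃ δ > 0, ∀ τ ∈ Set.Icc 0 T, ∀ h ∈ Set.Icc 0 δ, |F τ h - γ * h| ≤ ε * h)
    {ε : ℝ} (hε : 0 < ε) :
    ∀ᶠ n : ℕ in atTop, ∀ k < n,
      |F (T - (k + 1 : ℕ) * (T / n)) (T / n) - γ * (T / n)| ≤ ε * (T / n) := by
  obtain ⟨δ, hδ, hFδ⟩ := hF ε hε
  filter_upwards [(tendsto_const_div_atTop_nhds_zero_nat T).eventually (ge_mem_nhds hδ),
    eventually_gt_atTop 0] with n hnδ hn k hk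
  have hn' : (0 : ℝ) < n := by exact_mod_cast hn
  have hkn : ((k + 1 : ℕ) : ℝ) * (T / n) ≤ n * (T / n) := by
    gcongr
    exact hk
  rw [mul_div_cancel₀ _ hn'.ne'] at hkn
  exact hFδ _ ⟨by linarith, by linarith [show 0 ≤ ((k + 1 : ℕ) : ℝ) * (T / n) by positivity]⟩ _
    ⟨by positivity, hnδ⟩

/-- The exponent of the discrete Feynman–Kac weight along the grid of mesh `T / n`. -/
noncomputable def gridExponent (r : ℝ) (a b c : ℝ → ℝ) (T : ℝ) (n k : ℕ) (y : ℝ) : ℝ :=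
  -(stepQuad r a (T - (k + 1 : ℕ) * (T / n)) (T / n) * y ^ 2) / 2 +
    stepLin r a b (T - (k + 1 : ℕ) * (T / n)) (T / n) * y +
    stepConst r a b c (T - (k + 1 : ℕ) * (T / n)) (T / n)

@[fun_prop]
lemma measurable_gridExponent (r : ℝ) (a b c : ℝ → ℝ) (T : ℝ) (n k : ℕ) :
    Measurable (gridExponent r a b c T n k) := by
  unfold gridExponent
  fun_prop

lemma measurable_exp_sum_gridExponent (r : ℝ) (a b c : ℝ → ℝ) (T : ℝ) (n : ℕ)
    {X : ℝ → Ω → ℝ} (hX : ∀ t, Measurable (X t)) :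
    Measurable fun ω => Real.exp
      (∑ k ∈ Finset.range n, gridExponent r a b c T n k (X (k * (T / n)) ω)) := by
  fun_prop

namespace IsRiccatiSolution

variable {r θ μ T : ℝ} {a b c : ℝ → ℝ}

lemma tendsto_sum_gridExponent (H : IsRiccatiSolution r θ μ a b c) (hr : 0 < r) (hT : 0 < T)
    {f : ℝ → ℝ} (hf : ContinuousOn f (Set.Icc 0 T)) :
    Tendsto (fun n : ℕ => ∑ k ∈ Finset.range n, gridExponent r a b c T n k (f (k * (T / n))))
      atTop (𝓝 (-(θ ^ 2 / 2) * (∫ u in (0 : ℝ)..T, f u ^ 2) + μ * ∫ u in (0 : ℝ)..T, f u)) := by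
  have hq := tendsto_weighted_riemannSum hT (f := fun u => f u ^ 2) (hf.pow 2) fun ε hε =>
    eventually_forall_abs_sub_mul_le hT (fun ε hε => H.stepQuad_expansion hr hT hε) hε
  have hl := tendsto_weighted_riemannSum hT hf fun ε hε =>
    eventually_forall_abs_sub_mul_le hT (fun ε hε => H.stepLin_expansion hr hT hε) hε
  have hw := tendsto_weighted_riemannSum hT (continuousOn_const (c := (1 : ℝ))) fun ε hε =>
    eventually_forall_abs_sub_mul_le hT (fun ε hε => H.stepConst_expansion hr hT hε) hε
  convert ((hq.const_mul (-(1 / 2))).add hl).add hw using 1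
  · ext n
    rw [Finset.mul_sum, ← Finset.sum_add_distrib, ← Finset.sum_add_distrib]
    refine Finset.sum_congr rfl fun k _ => ?_
    rw [gridExponent]
    ring
  · congr 1
    ring

lemma exists_sum_gridExponent_le (H : IsRiccatiSolution r θ μ a b c) (hr : 0 < r) (hT : 0 < T)
    (hθ : 0 < θ) :
    ∃ C : ℝ, ∀ᶠ n : ℕ in atTop, ∀ y : ℕ → ℝ,
      ∑ k ∈ Finset.range n, gridExponent r a b c T n k (y k) ≤ C := by
  refine ⟨T * ((|μ| + 1) ^ 2 / θ ^ 2 + 1), ?_⟩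
  filter_upwards [eventually_forall_abs_sub_mul_le hT
      (fun ε hε => H.stepQuad_expansion hr hT hε) (show 0 < θ ^ 2 / 2 by positivity),
    eventually_forall_abs_sub_mul_le hT (fun ε hε => H.stepLin_expansion hr hT hε) one_pos,
    eventually_forall_abs_sub_mul_le hT (fun ε hε => H.stepConst_expansion hr hT hε) one_pos,
    eventually_gt_atTop 0] with n hq hl hw hn y
  have hn' : (0 : ℝ) < n := by exact_mod_cast hn
  have hn_ne : (n : ℝ) ≠ 0 := ne_of_gt hn'
  have hstep : ∀ k ∈ Finset.range n, gridExponent r a b c T n k (y k) ≤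
      T / n * ((|μ| + 1) ^ 2 / θ ^ 2 + 1) := by
    intro k hk
    replace hq := hq k (Finset.mem_range.1 hk)
    replace hl := hl k (Finset.mem_range.1 hk)
    replace hw := hw k (Finset.mem_range.1 hk)
    rw [gridExponent]
    generalize stepQuad r a _ _ = q at hq ⊢
    generalize stepLin r a b _ _ = l at hl ⊢
    generalize stepConst r a b c _ _ = w at hw ⊢
    generalize y k = y
    have hh : 0 < T / n := by positivity
    generalize T / n = h at *
    have hq' : θ ^ 2 / 2 * h ≤ q := by linarith [(abs_le.1 hq).1]
    have hl' : |l| ≤ (|μ| + 1) * h := by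
      calc |l| = |(l - μ * h) + μ * h| := by ring_nf
        _ ≤ |l - μ * h| + |μ * h| := abs_add_le _ _
        _ ≤ 1 * h + |μ| * h := by rw [abs_mul μ, abs_of_pos hh]; gcongr
        _ = _ := by ring
    have hw' : w ≤ h := by linarith [(abs_le.1 hw).2]
    have hly : l * y ≤ (|μ| + 1) * h * |y| := by
      calc l * y ≤ |l * y| := le_abs_self _
        _ = |l| * |y| := abs_mul _ _
        _ ≤ _ := by gcongr
    have hqy : θ ^ 2 / 2 * h * |y| ^ 2 ≤ q * y ^ 2 := by
      rw [sq_abs]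
      gcongr
    have hsq : 0 ≤ h * (θ * |y| / 2 - (|μ| + 1) / θ) ^ 2 := by positivity
    have hexp : h * (θ * |y| / 2 - (|μ| + 1) / θ) ^ 2 =
        θ ^ 2 / 2 * h * |y| ^ 2 / 2 - (|μ| + 1) * h * |y| + h * ((|μ| + 1) ^ 2 / θ ^ 2) := by
      field_simp
      ring
    linarith
  calc ∑ k ∈ Finset.range n, gridExponent r a b c T n k (y k)
      ≤ ∑ k ∈ Finset.range n, T / n * ((|μ| + 1) ^ 2 / θ ^ 2 + 1) := Finset.sum_le_sum hstep
    _ = _ := by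
      rw [Finset.sum_const, Finset.card_range, nsmul_eq_mul, ← mul_assoc,
        mul_div_cancel₀ _ hn_ne]

/-- The discrete Feynman–Kac formula for the Ornstein–Uhlenbeck process sampled on a grid. -/
lemma integral_exp_sum_gridExponent [IsProbabilityMeasure P] {W X : ℝ → Ω → ℝ}
    (H : IsRiccatiSolution r θ μ a b c) (hr : 0 < r) (hT : 0 < T) (hW : IsStdBM P W)
    (hX : IsOU r W X) {n : ℕ} (hn : 0 < n) :
    ∫ ω, Real.exp (∑ k ∈ Finset.range n, gridExponent r a b c T n k (X (k * (T / n)) ω)) ∂P =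
      Real.exp (c T) := by
  have hn' : (0 : ℝ) < n := by exact_mod_cast hn
  have hh : 0 < T / n := by positivity
  have hnh : n * (T / n) = T := mul_div_cancel₀ _ hn'.ne'
  have hmX := hX.measurable hW
  have hsucc (k : ℕ) : ((k + 1 : ℕ) : ℝ) * (T / n) = k * (T / n) + T / n := by push_cast; ring
  have key := lintegral_prod_weights_mul (P := P) (x := fun k : ℕ => X (k * (T / n)))
    (ν := gaussianReal 0 (ouVar r (T / n)).toNNReal) (ρ := Real.exp (-(r * (T / n))))
    (G := fun k y => ENNReal.ofReal (Real.exp (gridExponent r a b c T n k y)))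
    (v := fun k y => ENNReal.ofReal (Real.exp (-(a (T - k * (T / n)) * y ^ 2) / 2 +
      b (T - k * (T / n)) * y + c (T - k * (T / n)))))
    (fun k => hmX _)
    (fun k => by
      rw [hsucc]
      exact hX.hasLaw_innovation hr hW (by positivity) hh.le)
    (fun k => by
      rw [hsucc]
      have hmem (j : Set.Iic k) : ((j : ℕ) : ℝ) * (T / n) ∈ Set.Icc 0 (k * (T / n)) := by
        refine ⟨by positivity, ?_⟩
        gcongr
        exact j.2
      exact (hX.indepFun_innovation hr hW (by positivity) hh.le).comp measurable_id
        (ψ := fun p (j : Set.Iic k) => p ⟨(j : ℕ) * (T / n), hmem j⟩) (by fun_prop))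
    (fun k => by fun_prop) (fun k => by fun_prop) n
    (fun k hk y => by
      have hτ : 0 ≤ T - (k + 1 : ℕ) * (T / n) := by
        rw [sub_nonneg]
        conv_rhs => rw [← hnh]
        gcongr
        exact hk
      have := H.weight_mul_lintegral hr hτ hh y
      rwa [show T - (k + 1 : ℕ) * (T / n) + T / n = T - k * (T / n) by rw [hsucc]; ring] at this)
  simp only [hnh, sub_self, H.a_zero, H.b_zero, H.c_zero, CharP.cast_eq_zero, zero_mul,
    hX.apply_zero hW, neg_zero, zero_div, add_zero, Real.exp_zero, ENNReal.ofReal_one, mul_one,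
    sub_zero, ne_eq, OfNat.ofNat_ne_zero, not_false_eq_true, zero_pow, mul_zero, zero_add,
    lintegral_const, measure_univ] at key
  rw [integral_eq_lintegral_of_nonneg_ae (ae_of_all _ fun ω => Real.exp_nonneg _)
    (measurable_exp_sum_gridExponent r a b c T n hmX).aestronglyMeasurable]
  simp_rw [Real.exp_sum, ENNReal.ofReal_prod_of_nonneg fun _ _ => Real.exp_nonneg _]
  rw [key, ENNReal.toReal_ofReal (Real.exp_nonneg _)]

/-- The Feynman–Kac formula for the Ornstein–Uhlenbeck process started at `0` with a quadratic
potential. -/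
theorem integral_exp_quadratic_functional [IsProbabilityMeasure P] {W X : ℝ → Ω → ℝ}
    (H : IsRiccatiSolution r θ μ a b c) (hr : 0 < r) (hT : 0 < T) (hθ : 0 < θ)
    (hW : IsStdBM P W) (hX : IsOU r W X) :
    ∫ ω, Real.exp (-(θ ^ 2 / 2) * (∫ u in (0 : ℝ)..T, X u ω ^ 2) +
      μ * ∫ u in (0 : ℝ)..T, X u ω) ∂P = Real.exp (c T) := by
  obtain ⟨C, hC⟩ := H.exists_sum_gridExponent_le hr hT hθ
  have hmX := hX.measurable hW
  have hlim : Tendsto (fun n : ℕ => ∫ ω, Real.exp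
      (∑ k ∈ Finset.range n, gridExponent r a b c T n k (X (k * (T / n)) ω)) ∂P) atTop
      (𝓝 (∫ ω, Real.exp (-(θ ^ 2 / 2) * (∫ u in (0 : ℝ)..T, X u ω ^ 2) +
        μ * ∫ u in (0 : ℝ)..T, X u ω) ∂P)) := by
    refine tendsto_integral_filter_of_dominated_convergence (fun _ => Real.exp C) ?_ ?_
      (integrable_const _) ?_
    · exact Eventually.of_forall fun n =>
        (measurable_exp_sum_gridExponent r a b c T n hmX).aestronglyMeasurable
    · filter_upwards [hC] with n hn
      refine ae_of_all _ fun ω => ?_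
      rw [Real.norm_eq_abs, Real.abs_exp]
      exact Real.exp_le_exp.2 (hn fun k => X (k * (T / n)) ω)
    · refine ae_of_all _ fun ω => ?_
      have hcont : ContinuousOn (fun u => X u ω) (Set.Icc 0 T) :=
        (hX.continuousOn hr hW ω).mono Set.Icc_subset_Ici_self
      exact (H.tendsto_sum_gridExponent hr hT hcont).rexp
  refine tendsto_nhds_unique hlim (tendsto_const_nhds.congr' ?_)
  filter_upwards [eventually_gt_atTop 0] with n hn
  exact (H.integral_exp_sum_gridExponent hr hT hW hX hn).symm

end IsRiccatiSolution

/-- The denominator `η cosh (η τ) + r sinh (η τ)` of the explicit Riccati solution. -/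
noncomputable def riccatiDenom (r η τ : ℝ) : ℝ :=
  η * Real.cosh (η * τ) + r * Real.sinh (η * τ)

/-- The coefficient of `μ² / 2` in the constant part of the explicit Riccati solution. -/
noncomputable def riccatiGain (r θ η τ : ℝ) : ℝ :=
  τ / η ^ 2 + (r ^ 2 - θ ^ 2) / η ^ 4 * (Real.sinh (η * τ) / riccatiDenom r η τ) +
    2 * r / η ^ 3 * ((riccatiDenom r η τ)⁻¹ - η⁻¹)

lemma riccatiDenom_pos {r η : ℝ} (hr : 0 < r) (hrη : r < η) (τ : ℝ) :
    0 < riccatiDenom r η τ := by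
  have hc := Real.cosh_pos (η * τ)
  have h1 : 0 < Real.cosh (η * τ) + Real.sinh (η * τ) := by
    rw [Real.cosh_add_sinh]
    positivity
  rw [riccatiDenom]
  nlinarith

lemma hasDerivAt_cosh_mul (η τ : ℝ) :
    HasDerivAt (fun τ => Real.cosh (η * τ)) (η * Real.sinh (η * τ)) τ := by
  have hlin : HasDerivAt (fun τ => η * τ) η τ := by simpa using (hasDerivAt_id' τ).const_mul η
  exact hlin.cosh.congr_deriv (mul_comm _ _)

lemma hasDerivAt_sinh_mul (η τ : ℝ) :
    HasDerivAt (fun τ => Real.sinh (η * τ)) (η * Real.cosh (η * τ)) τ := by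
  have hlin : HasDerivAt (fun τ => η * τ) η τ := by simpa using (hasDerivAt_id' τ).const_mul η
  exact hlin.sinh.congr_deriv (mul_comm _ _)

lemma hasDerivAt_riccatiDenom (r η τ : ℝ) :
    HasDerivAt (riccatiDenom r η)
      (η * (η * Real.sinh (η * τ)) + r * (η * Real.cosh (η * τ))) τ :=
  ((hasDerivAt_cosh_mul η τ).const_mul η).add ((hasDerivAt_sinh_mul η τ).const_mul r)

lemma isRiccatiSolution_explicit {r θ η : ℝ} (hr : 0 < r) (hrη : r < η)
    (hθη : θ ^ 2 = η ^ 2 - r ^ 2) (μ : ℝ) :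
    IsRiccatiSolution r θ μ
      (fun τ => θ ^ 2 * Real.sinh (η * τ) / riccatiDenom r η τ)
      (fun τ => μ * (Real.sinh (η * τ) + r / η * (Real.cosh (η * τ) - 1)) / riccatiDenom r η τ)
      (fun τ => r * τ / 2 - Real.log (riccatiDenom r η τ / η) / 2 +
        μ ^ 2 / 2 * riccatiGain r θ η τ) := by
  have hη : 0 < η := hr.trans hrη
  have hD := riccatiDenom_pos hr hrη
  have hD0 : riccatiDenom r η 0 = η := by simp [riccatiDenom]
  refine ⟨by simp, by simp, by simp [riccatiGain, hD0, hη.ne'], fun τ hτ => ?_, fun τ => ?_,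
    fun τ => ?_, fun τ => ?_⟩
  · exact div_nonneg (mul_nonneg (sq_nonneg _) (Real.sinh_nonneg_iff.2 (by positivity))) (hD τ).le
  · have hne := (hD τ).ne'
    refine (((hasDerivAt_sinh_mul η τ).const_mul (θ ^ 2)).div
      (hasDerivAt_riccatiDenom r η τ) hne).congr_deriv ?_
    field_simp
    rw [hθη, riccatiDenom]
    ring
  · have hne := (hD τ).ne'
    refine ((((hasDerivAt_sinh_mul η τ).add
      (((hasDerivAt_cosh_mul η τ).sub_const 1).const_mul (r / η))).const_mul μ).div
      (hasDerivAt_riccatiDenom r η τ) hne).congr_deriv ?_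
    simp only [Pi.add_apply]
    field_simp
    rw [hθη, riccatiDenom]
    ring
  · have hne := (hD τ).ne'
    have hcs := Real.cosh_sq (η * τ)
    have hDη : riccatiDenom r η τ / η ≠ 0 := by positivity
    have hgain := ((((hasDerivAt_id' τ).div_const (η ^ 2)).add
      (((hasDerivAt_sinh_mul η τ).div (hasDerivAt_riccatiDenom r η τ) hne).const_mul
        ((r ^ 2 - θ ^ 2) / η ^ 4))).add
      ((((hasDerivAt_riccatiDenom r η τ).inv hne).sub_const η⁻¹).const_mul (2 * r / η ^ 3)))
    refine (((((hasDerivAt_id' τ).const_mul r).div_const 2).sub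
      ((((hasDerivAt_riccatiDenom r η τ).div_const η).log hDη).div_const 2)).add
      (hgain.const_mul (μ ^ 2 / 2))).congr_deriv ?_
    field_simp
    rw [hθη, riccatiDenom]
    linear_combination (η * r ^ 2 * μ ^ 2) * hcs

/-- Pathwise integrals of a process with continuous paths are measurable. -/
lemma measurable_intervalIntegral_of_continuousOn {Y : ℝ → Ω → ℝ} {T : ℝ} (hT : 0 < T)
    (hY : ∀ t, Measurable (Y t)) (hc : ∀ ω, ContinuousOn (fun t => Y t ω) (Set.Icc 0 T)) :
    Measurable fun ω => ∫ u in (0 : ℝ)..T, Y u ω := by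
  refine measurable_of_tendsto_metrizable
    (f := fun (n : ℕ) ω => ∑ k ∈ Finset.range n, T / n * Y (k * (T / n)) ω)
    (fun n => Finset.measurable_fun_sum _ fun k _ => (hY _).const_mul _)
    (tendsto_pi_nhds.2 fun ω => ?_)
  have := tendsto_weighted_riemannSum (γ := 1) (φ := fun n _ => T / n) hT (hc ω)
    fun ε hε => Eventually.of_forall fun n k _ => by
      rw [one_mul, sub_self, abs_zero]
      positivity
  simpa using this

/-- The integrated squared deviation from the time average. -/
lemma integral_sub_average_sq {f : ℝ → ℝ} {T : ℝ} (hT : 0 < T)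
    (hf : ContinuousOn f (Set.Icc 0 T)) :
    ∫ u in (0 : ℝ)..T, (f u - T⁻¹ * ∫ v in (0 : ℝ)..T, f v) ^ 2 =
      (∫ u in (0 : ℝ)..T, f u ^ 2) - (∫ u in (0 : ℝ)..T, f u) ^ 2 / T := by
  rw [← Set.uIcc_of_le hT.le] at hf
  set m := ∫ v in (0 : ℝ)..T, f v with hm
  have hexp (u : ℝ) : (f u - T⁻¹ * m) ^ 2 = f u ^ 2 - 2 * (T⁻¹ * m) * f u + (T⁻¹ * m) ^ 2 := by
    ring
  have h1 : IntervalIntegrable (fun u => f u ^ 2) volume 0 T := (hf.pow 2).intervalIntegrable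
  have h2 : IntervalIntegrable (fun u => 2 * (T⁻¹ * m) * f u) volume 0 T :=
    hf.intervalIntegrable.const_mul _
  simp_rw [hexp]
  rw [intervalIntegral.integral_add (h1.sub h2) intervalIntegrable_const,
    intervalIntegral.integral_sub h1 h2, intervalIntegral.integral_const_mul,
    intervalIntegral.integral_const, ← hm, smul_eq_mul]
  field_simp
  ring

/-- Gaussian linearization of the square in an exponential weight. -/
lemma ofReal_exp_eq_lintegral_gaussianReal {T : ℝ} (hT : 0 < T) (θ A B : ℝ) :
    ENNReal.ofReal (Real.exp (-(θ ^ 2 / 2) * (A - B ^ 2 / T))) =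
      ∫⁻ z, ENNReal.ofReal (Real.exp (-(θ ^ 2 / 2) * A + θ / √T * z * B))
        ∂gaussianReal 0 1 := by
  have h := lintegral_exp_quadratic_gaussianReal one_ne_zero 0 (θ / √T * B) (by simp)
  have hsplit (z : ℝ) : ENNReal.ofReal (Real.exp (-(θ ^ 2 / 2) * A + θ / √T * z * B)) =
      ENNReal.ofReal (Real.exp (-(θ ^ 2 / 2) * A)) *
        ENNReal.ofReal (Real.exp (-(0 * z ^ 2) / 2 + θ / √T * B * z)) := by
    rw [← ENNReal.ofReal_mul (Real.exp_nonneg _), ← Real.exp_add]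
    ring_nf
  simp_rw [hsplit]
  rw [lintegral_const_mul _ (by fun_prop), h, ← ENNReal.ofReal_mul (Real.exp_nonneg _)]
  simp only [add_zero, Real.sqrt_one, inv_one, one_mul, NNReal.coe_one, mul_one]
  rw [← Real.exp_add, mul_pow, div_pow, Real.sq_sqrt hT.le]
  ring_nf

lemma one_sub_mul_riccatiGain {r θ η T : ℝ} (hr : 0 < r) (hrη : r < η) (hT : 0 < T)
    (hθη : θ ^ 2 = η ^ 2 - r ^ 2) :
    1 - θ ^ 2 / T * riccatiGain r θ η T = η / (T * riccatiDenom r η T) *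
      ((θ ^ 2 / η ^ 4) * (2 * r * (Real.cosh (η * T) - 1) + η * Real.sinh (η * T)) +
        (r ^ 2 * T / η ^ 3) * riccatiDenom r η T) := by
  have hη : η ≠ 0 := (hr.trans hrη).ne'
  have hD := (riccatiDenom_pos hr hrη T).ne'
  rw [riccatiGain]
  field_simp
  rw [hθη, riccatiDenom, mul_comm T η]
  ring

end

theorem stmt_8 {Ω : Type*} [MeasurableSpace Ω] (P : Measure Ω) [IsProbabilityMeasure P]
    (r : ℝ) (hr : 0 < r) (W : ℝ → Ω → ℝ) (hW : IsStdBM P W)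
    (X : ℝ → Ω → ℝ)
    (hX : ∀ t ω, X t ω = Real.exp (-r * t) * W ((Real.exp (2 * r * t) - 1) / (2 * r)) ω)
    (T θ η : ℝ) (hT : 0 < T) (hθ : 0 < θ) (hη : η = Real.sqrt (r ^ 2 + θ ^ 2)) :
    ∫ ω, Real.exp (-(θ ^ 2 / 2) *
        ∫ u in (0:ℝ)..T, (X u ω - T⁻¹ * ∫ v in (0:ℝ)..T, X v ω) ^ 2) ∂P
      = Real.sqrt T * Real.exp (r * T / 2) *
        (Real.sqrt
          ((θ ^ 2 / η ^ 4) * (2 * r * (Real.cosh (η * T) - 1) + η * Real.sinh (η * T)) +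
           (r ^ 2 * T / η ^ 3) * (η * Real.cosh (η * T) + r * Real.sinh (η * T))))⁻¹ := by
  have hOU : IsOU r W X := hX
  have hrη : r < η := by
    rw [hη]
    exact Real.lt_sqrt_of_sq_lt (by linarith [pow_pos hθ 2])
  have hη0 : 0 < η := hr.trans hrη
  have hθη : θ ^ 2 = η ^ 2 - r ^ 2 := by
    rw [hη, Real.sq_sqrt (by positivity)]
    ring
  have hc (ω : Ω) : ContinuousOn (fun t => X t ω) (Set.Icc 0 T) :=
    (hOU.continuousOn hr hW ω).mono Set.Icc_subset_Ici_self
  have hA : Measurable fun ω => ∫ u in (0 : ℝ)..T, X u ω ^ 2 :=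
    measurable_intervalIntegral_of_continuousOn (Y := fun u ω => X u ω ^ 2) hT
      (fun t => (hOU.measurable hW t).pow_const 2) fun ω => (hc ω).pow 2
  have hB : Measurable fun ω => ∫ u in (0 : ℝ)..T, X u ω :=
    measurable_intervalIntegral_of_continuousOn hT (hOU.measurable hW) hc
  have hD := riccatiDenom_pos hr hrη T
  set S := (θ ^ 2 / η ^ 4) * (2 * r * (Real.cosh (η * T) - 1) + η * Real.sinh (η * T)) +
    (r ^ 2 * T / η ^ 3) * riccatiDenom r η T with hSdef
  have hS : 0 < S := by
    have h1 : 0 ≤ Real.cosh (η * T) - 1 := sub_nonneg.2 (Real.one_le_cosh _)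
    have h2 : 0 < Real.sinh (η * T) := Real.sinh_pos_iff.2 (by positivity)
    positivity
  change _ = √T * Real.exp (r * T / 2) * (√S)⁻¹
  have hgain : 1 + -(θ ^ 2 / T * riccatiGain r θ η T) = η / (T * riccatiDenom r η T) * S := by
    rw [← sub_eq_add_neg, one_sub_mul_riccatiGain hr hrη hT hθη]
  have hinner (z : ℝ) : ∫⁻ ω, ENNReal.ofReal (Real.exp (-(θ ^ 2 / 2) *
        (∫ u in (0 : ℝ)..T, X u ω ^ 2) + θ / √T * z * ∫ u in (0 : ℝ)..T, X u ω)) ∂P =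
      ENNReal.ofReal (Real.exp (r * T / 2) * √(η / riccatiDenom r η T)) *
        ENNReal.ofReal (Real.exp (-(-(θ ^ 2 / T * riccatiGain r θ η T) * z ^ 2) / 2 + 0 * z)) := by
    have h := (isRiccatiSolution_explicit hr hrη hθη
      (θ / √T * z)).integral_exp_quadratic_functional hr hT hθ hW hOU
    rw [← ofReal_integral_eq_lintegral_ofReal
      (.of_integral_ne_zero (by rw [h]; positivity)) (ae_of_all _ fun _ => Real.exp_nonneg _), h,
      ← ENNReal.ofReal_mul (by positivity)]
    congr 1
    have hsqrt : √(η / riccatiDenom r η T) =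
        Real.exp (-(Real.log (riccatiDenom r η T / η) / 2)) := by
      rw [← inv_div, Real.sqrt_inv, Real.exp_neg, Real.exp_half, Real.exp_log (by positivity)]
    rw [hsqrt, ← Real.exp_add, ← Real.exp_add, mul_pow, div_pow, Real.sq_sqrt hT.le]
    ring_nf
  have hkey : ∫⁻ ω, ENNReal.ofReal (Real.exp (-(θ ^ 2 / 2) *
        ∫ u in (0:ℝ)..T, (X u ω - T⁻¹ * ∫ v in (0:ℝ)..T, X v ω) ^ 2)) ∂P =
      ENNReal.ofReal (√T * Real.exp (r * T / 2) * (√S)⁻¹) := by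
    have hmeas : Measurable (Function.uncurry fun ω z => ENNReal.ofReal (Real.exp
        (-(θ ^ 2 / 2) * (∫ u in (0 : ℝ)..T, X u ω ^ 2) +
          θ / √T * z * ∫ u in (0 : ℝ)..T, X u ω))) :=
      (((hA.comp measurable_fst).const_mul _).add
        ((measurable_snd.const_mul _).mul (hB.comp measurable_fst))).exp.ennreal_ofReal
    simp_rw [integral_sub_average_sq hT (hc _), ofReal_exp_eq_lintegral_gaussianReal hT]
    rw [lintegral_lintegral_swap hmeas.aemeasurable]
    simp_rw [hinner]
    rw [lintegral_const_mul _ (by fun_prop),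
      lintegral_exp_quadratic_gaussianReal one_ne_zero _ _
        (by rw [NNReal.coe_one, mul_one, hgain]; positivity),
      ← ENNReal.ofReal_mul (by positivity), NNReal.coe_one, mul_one, hgain]
    congr 1
    have hsplit : η / (T * riccatiDenom r η T) * S = η / riccatiDenom r η T * S / T := by
      field_simp
    have hq : 0 < η / riccatiDenom r η T := by positivity
    rw [hsplit]
    generalize η / riccatiDenom r η T = q at hq
    rw [Real.sqrt_div (by positivity), Real.sqrt_mul hq.le, inv_div, zero_pow two_ne_zero,
      zero_mul, zero_div, Real.exp_zero]
    field_simp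
  rw [integral_eq_lintegral_of_nonneg_ae (ae_of_all _ fun _ => Real.exp_nonneg _) ?_, hkey,
    ENNReal.toReal_ofReal (by positivity)]
  simp_rw [integral_sub_average_sq hT (hc _)]
  exact Measurable.aestronglyMeasurable (by fun_prop)
end

section
/- Let W₁, W₂ be independent standard Brownian motions, let c ∈ (−1, 1), and define the correlated Brownian motions X₁(t) = W₁(t), X₂(t) = c W₁(t) + √(1 − c²) W₂(t). Let S be a 2 × 2 real symmetric positive semidefinite matrix with entries s_ij, and define λ₁² and λ₂² by λ_{1,2}² = (1/2) { s₁₁ + s₂₂ + 2 c s₁₂ ± √( (s₁₁ − s₂₂)² + 4 (c s₁₁ + s₁₂)(c s₂₂ + s₁₂) ) }, with λ₁, λ₂ > 0. Then, writing X(u) = (X₁(u), X₂(u)) and X̄ = ∫_0^1 X(u) du, one has E[ exp( −(1/2) ∫_0^1 (X(u) − X̄) · S (X(u) − X̄) du ) ] = ( λ₁ λ₂ / ( sinh λ₁ · sinh λ₂ ) )^{1/2}. -/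
open MeasureTheory ProbabilityTheory Filter Matrix

open scoped Topology

theorem tendsto_prod_one_add_sq_div {l : ℝ} (hl : l ≠ 0) :
    Tendsto (fun n : ℕ => ∏ k ∈ Finset.range n, (1 + l ^ 2 / (Real.pi * (k + 1)) ^ 2))
      atTop (𝓝 (Real.sinh l / l)) := by
  have h := Complex.tendsto_euler_sin_prod (l / Real.pi * Complex.I)
  have hpi : (Real.pi : ℂ) ≠ 0 := by exact_mod_cast Real.pi_ne_zero
  have hlC : (l : ℂ) ≠ 0 := by exact_mod_cast hl
  have h2 := (Complex.continuous_re.tendsto _).comp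
    (h.mul_const ((l : ℂ) * Complex.I)⁻¹)
  have e1 : (Real.pi : ℂ) * (l / Real.pi * Complex.I) = l * Complex.I := by
    field_simp
  have e3 : Complex.sinh l * Complex.I * ((l : ℂ) * Complex.I)⁻¹ =
      ((Real.sinh l / l : ℝ) : ℂ) := by
    push_cast
    field_simp [Complex.I_ne_zero]
  rw [e1, Complex.sin_mul_I, e3, Complex.ofReal_re] at h2
  refine h2.congr fun n => ?_
  have e2 : (l : ℂ) * Complex.I * (∏ j ∈ Finset.range n,
      ((1 : ℂ) - (l / Real.pi * Complex.I) ^ 2 / ((j : ℂ) + 1) ^ 2)) * (l * Complex.I)⁻¹ =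
      ((∏ k ∈ Finset.range n, (1 + l ^ 2 / (Real.pi * (k + 1)) ^ 2) : ℝ) : ℂ) := by
    rw [mul_right_comm, mul_inv_cancel₀ (mul_ne_zero hlC Complex.I_ne_zero), one_mul]
    push_cast
    refine Finset.prod_congr rfl fun k _ => ?_
    rw [mul_pow, Complex.I_sq, div_pow, mul_pow]
    have : (k : ℂ) + 1 ≠ 0 := by exact_mod_cast Nat.succ_ne_zero k
    field_simp
    ring
  simp only [Function.comp]
  rw [e2, Complex.ofReal_re]

theorem integral_exp_neg_mul_sq_gaussianReal (v : NNReal) {b : ℝ} (hb : 0 ≤ b) :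
    ∫ x, Real.exp (-b * x ^ 2) ∂(gaussianReal 0 v) = (Real.sqrt (1 + 2 * b * v))⁻¹ := by
  rcases eq_or_ne v 0 with rfl | hv
  · simp
  have hv' : (0 : ℝ) < v := by exact_mod_cast hv.bot_lt
  rw [integral_gaussianReal_eq_integral_smul hv]
  have : ∀ x : ℝ, gaussianPDFReal 0 v x • Real.exp (-b * x ^ 2) =
      (Real.sqrt (2 * Real.pi * v))⁻¹ * Real.exp (-(b + 1 / (2 * v)) * x ^ 2) := by
    intro x
    rw [gaussianPDFReal, smul_eq_mul, mul_assoc, ← Real.exp_add]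
    congr 2
    field_simp
    ring
  simp_rw [this]
  rw [integral_const_mul, integral_gaussian, ← Real.sqrt_inv, ← Real.sqrt_inv, ← Real.sqrt_mul
    (by positivity)]
  congr 1
  field_simp
  ring

/-- The `(k+1)`-st cosine coefficient of `f` on `[0, 1]`. -/
noncomputable def cosCoeff (f : ℝ → ℝ) (k : ℕ) : ℝ :=
  ∫ u in (0 : ℝ)..1, Real.cos (Real.pi * (k + 1) * u) * f u

theorem fourierCoeffOn_even {f : ℝ → ℝ} (hf : ContinuousOn f (Set.Icc 0 1)) (n : ℤ) :
    fourierCoeffOn (show (-1 : ℝ) < 1 by norm_num) (fun x => (f |x| : ℂ)) n =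
      ((∫ u in (0 : ℝ)..1, Real.cos (Real.pi * n * u) * f u : ℝ) : ℂ) := by
  have hg : ContinuousOn (fun x => (f |x| : ℂ)) (Set.Icc (-1) 1) :=
    Complex.continuous_ofReal.comp_continuousOn
      (hf.comp continuous_abs.continuousOn fun x hx => ⟨abs_nonneg x, abs_le.2 hx⟩)
  have hi : ContinuousOn (fun x : ℝ => fourier (-n) (x : AddCircle ((1 : ℝ) - -1)) •
      (f |x| : ℂ)) (Set.Icc (-1) 1) :=
    (((map_continuous (fourier (-n))).comp
      (AddCircle.continuous_mk' _)).continuousOn).smul hg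
  have hneg : ∫ x in (-1 : ℝ)..0, fourier (-n) (x : AddCircle ((1 : ℝ) - -1)) • (f |x| : ℂ) =
      ∫ x in (0 : ℝ)..1, fourier (-n) ((-x : ℝ) : AddCircle ((1 : ℝ) - -1)) • (f |x| : ℂ) := by
    have := intervalIntegral.integral_comp_neg (a := 0) (b := 1)
      (fun x : ℝ => fourier (-n) (x : AddCircle ((1 : ℝ) - -1)) • (f |x| : ℂ))
    simp only [abs_neg, neg_zero] at this
    exact this.symm
  have hi₀ : IntervalIntegrable (fun x : ℝ => fourier (-n) (x : AddCircle ((1 : ℝ) - -1)) •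
      (f |x| : ℂ)) volume 0 1 :=
    (hi.mono (by rw [Set.uIcc_of_le zero_le_one]; exact Set.Icc_subset_Icc_left (by simp)))
      |>.intervalIntegrable
  have hi₁ : IntervalIntegrable (fun x : ℝ => fourier (-n) (x : AddCircle ((1 : ℝ) - -1)) •
      (f |x| : ℂ)) volume (-1) 0 :=
    (hi.mono (by rw [Set.uIcc_of_le (by simp)]; exact Set.Icc_subset_Icc_right (by simp)))
      |>.intervalIntegrable
  have hi₂ : IntervalIntegrable (fun x : ℝ =>
      fourier (-n) ((-x : ℝ) : AddCircle ((1 : ℝ) - -1)) • (f |x| : ℂ)) volume 0 1 := by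
    refine ContinuousOn.intervalIntegrable ?_
    rw [Set.uIcc_of_le zero_le_one]
    exact (((map_continuous (fourier (-n))).comp
      ((AddCircle.continuous_mk' _).comp continuous_neg)).continuousOn).smul
        (hg.mono (Set.Icc_subset_Icc_left (by simp)))
  rw [fourierCoeffOn_eq_integral, ← intervalIntegral.integral_add_adjacent_intervals hi₁ hi₀,
    hneg, ← intervalIntegral.integral_add hi₂ hi₀, ← intervalIntegral.integral_smul,
    ← intervalIntegral.integral_ofReal]
  refine intervalIntegral.integral_congr fun x hx => ?_
  rw [Set.uIcc_of_le zero_le_one] at hx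
  simp only [fourier_coe_apply, abs_of_nonneg hx.1]
  push_cast
  rw [Complex.cos, ← add_smul, smul_eq_mul, Complex.real_smul, ← mul_assoc]
  congr 1
  push_cast
  rw [show 2 * (Real.pi : ℂ) * Complex.I * -n * -x / (1 - -1) = Real.pi * n * x * Complex.I by ring,
    show 2 * (Real.pi : ℂ) * Complex.I * -n * x / (1 - -1) = -(Real.pi * n * x) * Complex.I by ring]
  ring

theorem hasSum_cosCoeff {f : ℝ → ℝ} (hf : ContinuousOn f (Set.Icc 0 1)) :
    HasSum (fun k => 2 * cosCoeff f k ^ 2)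
      (∫ u in (0 : ℝ)..1, (f u - ∫ v in (0 : ℝ)..1, f v) ^ 2) := by
  have hg : ContinuousOn (fun x => (f |x| : ℂ)) (Set.Icc (-1) 1) :=
    Complex.continuous_ofReal.comp_continuousOn
      (hf.comp continuous_abs.continuousOn fun x hx => ⟨abs_nonneg x, abs_le.2 hx⟩)
  have hL2 : MemLp (fun x => (f |x| : ℂ)) 2 (volume.restrict (Set.Ioc (-1) 1)) := by
    obtain ⟨C, hC⟩ := isCompact_Icc.exists_bound_of_continuousOn hg
    refine MemLp.of_bound ((hg.mono Set.Ioc_subset_Icc_self).aestronglyMeasurable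
      measurableSet_Ioc) C ?_
    filter_upwards [ae_restrict_mem measurableSet_Ioc] with x hx
    exact hC x (Set.Ioc_subset_Icc_self hx)
  have h := hasSum_sq_fourierCoeffOn (show (-1 : ℝ) < 1 by norm_num) hL2
  simp_rw [fourierCoeffOn_even hf] at h
  have h2 := (hasSum_nat_add_iff' 1).2 h.nat_add_neg
  have hfint : IntervalIntegrable f volume 0 1 :=
    ContinuousOn.intervalIntegrable (by rwa [Set.uIcc_of_le zero_le_one])
  have hfint2 : IntervalIntegrable (fun u => f u ^ 2) volume 0 1 :=
    ContinuousOn.intervalIntegrable (by rw [Set.uIcc_of_le zero_le_one]; exact hf.pow 2)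
  have heven : ∫ x in (-1 : ℝ)..1, ‖(f |x| : ℂ)‖ ^ 2 = 2 * ∫ x in (0 : ℝ)..1, f x ^ 2 := by
    have hc : ContinuousOn (fun x => f |x| ^ 2) (Set.Icc (-1) 1) :=
      (hf.comp continuous_abs.continuousOn fun x hx => ⟨abs_nonneg x, abs_le.2 hx⟩).pow 2
    have hfint₀ : IntervalIntegrable (fun u => f |u| ^ 2) volume 0 1 :=
      (hc.mono (by rw [Set.uIcc_of_le zero_le_one]; exact Set.Icc_subset_Icc_left (by simp)))
        |>.intervalIntegrable
    have hfint₁ : IntervalIntegrable (fun u => f |u| ^ 2) volume (-1) 0 :=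
      (hc.mono (by rw [Set.uIcc_of_le (by simp)]; exact Set.Icc_subset_Icc_right (by simp)))
        |>.intervalIntegrable
    have hneg := intervalIntegral.integral_comp_neg (a := 0) (b := 1) (fun x : ℝ => f |x| ^ 2)
    simp only [abs_neg, neg_zero] at hneg
    have hpos : ∫ x in (0 : ℝ)..1, f |x| ^ 2 = ∫ x in (0 : ℝ)..1, f x ^ 2 := by
      refine intervalIntegral.integral_congr fun x hx => ?_
      rw [Set.uIcc_of_le zero_le_one] at hx
      simp only [abs_of_nonneg hx.1]
    simp only [Complex.norm_real, Real.norm_eq_abs, sq_abs]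
    rw [← intervalIntegral.integral_add_adjacent_intervals hfint₁ hfint₀, ← hneg, hpos, two_mul]
  have hvar : ∫ u in (0 : ℝ)..1, (f u - ∫ v in (0 : ℝ)..1, f v) ^ 2 =
      (∫ u in (0 : ℝ)..1, f u ^ 2) - (∫ v in (0 : ℝ)..1, f v) ^ 2 := by
    generalize hm : ∫ v in (0 : ℝ)..1, f v = m
    simp_rw [sub_sq]
    rw [intervalIntegral.integral_add (hfint2.sub ((hfint.const_mul 2).mul_const m))
      intervalIntegrable_const, intervalIntegral.integral_sub hfint2
      ((hfint.const_mul 2).mul_const m), intervalIntegral.integral_mul_const,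
      intervalIntegral.integral_const_mul, hm]
    simp
    ring
  rw [hvar]
  rw [heven] at h2
  simp only [Complex.norm_real, Real.norm_eq_abs, sq_abs, Int.cast_neg, mul_neg, neg_mul,
    Real.cos_neg, Int.cast_natCast, Finset.sum_range_one, Nat.cast_zero, Int.cast_zero,
    mul_zero, zero_mul, Real.cos_zero, one_mul, Nat.cast_add, Nat.cast_one, Int.cast_add,
    Int.cast_one] at h2
  convert! h2 using 1
  · ext k
    rw [two_mul, cosCoeff]
  · norm_num
    ring

theorem tendsto_sum_sub_mul {f H h : ℝ → ℝ} (hf : ContinuousOn f (Set.Icc 0 1))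
    (hH : ∀ x, HasDerivAt H (h x) x) (hh : Continuous h) :
    Tendsto (fun n : ℕ => ∑ j ∈ Finset.range n,
      (H ((j + 1 : ℕ) / n) - H (j / n)) * f (j / n)) atTop (𝓝 (∫ u in (0 : ℝ)..1, h u * f u)) := by
  obtain ⟨C, hC⟩ := isCompact_Icc.exists_bound_of_continuousOn (s := Set.Icc (0 : ℝ) 1)
    hh.continuousOn
  have hC0 : 0 ≤ C := (norm_nonneg _).trans (hC 0 (by simp))
  rw [Metric.tendsto_atTop]
  intro ε hε
  have hu := isCompact_Icc.uniformContinuousOn_of_continuous hf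
  obtain ⟨δ, hδ, hfδ⟩ := Metric.uniformContinuousOn_iff.1 hu (ε / (C + 1)) (by positivity)
  obtain ⟨N, hN⟩ := exists_nat_gt (1 / δ)
  refine ⟨N + 1, fun n hn => ?_⟩
  have hn0 : (0 : ℝ) < n := by exact_mod_cast (by lia : 0 < n)
  have hNn : (N : ℝ) < n := by exact_mod_cast (by lia : N < n)
  have hnδ : 1 / (n : ℝ) < δ := by
    rw [div_lt_iff₀ hn0]
    rw [div_lt_iff₀ hδ] at hN
    nlinarith
  have hsub : ∀ j ∈ Finset.range n, Set.Icc ((j : ℝ) / n) ((j + 1 : ℕ) / n) ⊆ Set.Icc 0 1 := by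
    intro j hj
    refine Set.Icc_subset_Icc (by positivity) ?_
    rw [div_le_one hn0]
    exact_mod_cast Finset.mem_range.1 hj
  have hle : ∀ j : ℕ, (j : ℝ) / n ≤ (j + 1 : ℕ) / n := fun j => by gcongr; simp
  have hii : ∀ j ∈ Finset.range n,
      IntervalIntegrable (fun u => h u * f u) volume ((j : ℝ) / n) ((j + 1 : ℕ) / n) := by
    intro j hj
    refine ContinuousOn.intervalIntegrable ?_
    rw [Set.uIcc_of_le (hle j)]
    exact hh.continuousOn.mul (hf.mono (hsub j hj))
  have hsum := intervalIntegral.sum_integral_adjacent_intervals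
    (a := fun j : ℕ => (j : ℝ) / n) (f := fun u => h u * f u) (μ := volume) (n := n)
    (fun j hj => hii j (Finset.mem_range.2 hj))
  simp only [Nat.cast_zero, zero_div, div_self hn0.ne'] at hsum
  rw [← hsum, dist_eq_norm, ← Finset.sum_sub_distrib]
  calc ‖∑ j ∈ Finset.range n, ((H ((j + 1 : ℕ) / n) - H (j / n)) * f (j / n) -
        ∫ u in ((j : ℝ) / n)..((j + 1 : ℕ) / n), h u * f u)‖
      ≤ ∑ j ∈ Finset.range n, C * (ε / (C + 1)) * (1 / n) := by
        refine norm_sum_le_of_le _ fun j hj => ?_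
        rw [← intervalIntegral.integral_eq_sub_of_hasDerivAt (fun x _ => hH x)
          (hh.intervalIntegrable _ _), ← intervalIntegral.integral_mul_const,
          ← intervalIntegral.integral_sub ((hh.intervalIntegrable _ _).mul_const _) (hii j hj)]
        have hlen : |((j + 1 : ℕ) : ℝ) / n - j / n| = 1 / n := by
          rw [← sub_div, Nat.cast_add_one, add_sub_cancel_left, abs_of_pos (by positivity)]
        rw [← hlen]
        refine intervalIntegral.norm_integral_le_of_norm_le_const fun x hx => ?_
        rw [Set.uIoc_of_le (hle j)] at hx
        have hx' := Set.Ioc_subset_Icc_self hx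
        rw [← mul_sub, norm_mul]
        refine mul_le_mul (hC x (hsub j hj hx')) ?_ (norm_nonneg _) hC0
        rw [← dist_eq_norm]
        refine (hfδ _ (hsub j hj (Set.left_mem_Icc.2 (hle j))) _ (hsub j hj hx') ?_).le
        rw [dist_comm, Real.dist_eq, abs_of_nonneg (by linarith [hx.1])]
        have : x - j / n ≤ ((j + 1 : ℕ) : ℝ) / n - j / n := by linarith [hx.2]
        have h3 := (le_abs_self _).trans_eq hlen
        linarith
    _ = C / (C + 1) * ε := by
        rw [Finset.sum_const, Finset.card_range, nsmul_eq_mul]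
        field_simp
    _ < ε := by
        have : C / (C + 1) < 1 := by rw [div_lt_one (by positivity)]; linarith
        nlinarith

theorem sum_sum_mul_min (n : ℕ) (c : ℕ → ℝ) :
    ∑ i ∈ Finset.range n, ∑ j ∈ Finset.range n, c i * c j * (min i j : ℕ) =
      ∑ m ∈ Finset.range n, (∑ i ∈ Finset.Ico (m + 1) n, c i) ^ 2 := by
  have h1 : ∀ m ∈ Finset.range n, ∑ i ∈ Finset.Ico (m + 1) n, c i =
      ∑ i ∈ Finset.range n, if m < i then c i else 0 := by
    intro m _
    rw [← Finset.sum_filter]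
    congr 1
    ext i
    simp only [Finset.mem_Ico, Finset.mem_filter, Finset.mem_range]
    lia
  have h3 : ∑ m ∈ Finset.range n, (∑ i ∈ Finset.Ico (m + 1) n, c i) ^ 2 =
      ∑ m ∈ Finset.range n, ∑ i ∈ Finset.range n, ∑ j ∈ Finset.range n,
        (if m < i then c i else 0) * if m < j then c j else 0 :=
    Finset.sum_congr rfl fun m hm => by rw [h1 m hm, sq, Finset.sum_mul_sum]
  symm
  rw [h3, Finset.sum_comm]
  refine Finset.sum_congr rfl fun i hi => ?_
  rw [Finset.sum_comm]
  refine Finset.sum_congr rfl fun j hj => ?_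
  have h2 : ∀ m, ((if m < i then c i else 0) * if m < j then c j else 0) =
      if m < min i j then c i * c j else 0 := by
    intro m
    by_cases h : m < i <;> by_cases h' : m < j <;> simp [h, h']
  simp_rw [h2]
  rw [← Finset.sum_filter, Finset.sum_const, nsmul_eq_mul, mul_comm]
  congr 2
  rw [Finset.mem_range] at hi
  have : Finset.filter (fun m => m < min i j) (Finset.range n) = Finset.range (min i j) := by
    ext m
    simp only [Finset.mem_filter, Finset.mem_range]
    lia
  rw [this, Finset.card_range]

section BrownianMotion

variable {Ω : Type*} [MeasurableSpace Ω] {P : Measure Ω}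

theorem IsStdBM.map_sum_sub_mul {W : ℝ → Ω → ℝ} (hW : IsStdBM P W) {H : ℝ → ℝ}
    (hH0 : H 0 = 0) (hH1 : H 1 = 0) {n : ℕ} (hn : n ≠ 0) :
    P.map (fun ω => ∑ j ∈ Finset.range n, (H ((j + 1 : ℕ) / n) - H (j / n)) * W (j / n) ω) =
      gaussianReal 0
        (∑ j ∈ Finset.range n, (((j + 1 : ℕ) : ℝ) / n - j / n) * H (j / n) ^ 2).toNNReal := by
  have hn0 : (0 : ℝ) < n := by exact_mod_cast hn.bot_lt
  have h := hW.2.2.2 n (fun j => (j : ℝ) / n) (fun j => H ((j + 1 : ℕ) / n) - H (j / n))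
    (fun i => by positivity)
  simp only [Finset.sum_range]
  rw [h]
  congr 2
  have h2 := sum_sum_mul_min n (fun j => H ((j + 1 : ℕ) / n) - H (j / n))
  have h3 : ∀ i j : ℕ, min ((i : ℝ) / n) (j / n) = (min i j : ℕ) * (1 / n) := by
    intro i j
    rw [min_div_div_right hn0.le, Nat.cast_min]
    ring
  simp_rw [h3, ← mul_assoc, ← Finset.sum_mul]
  simp only [Finset.sum_range] at h2
  rw [h2]
  simp only [← Finset.sum_range (fun m : ℕ => (∑ i ∈ Finset.Ico (m + 1) n,
    (H ((i + 1 : ℕ) / n) - H (i / n))) ^ 2),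
    ← Finset.sum_range (fun j : ℕ => (((j + 1 : ℕ) : ℝ) / n - j / n) * H (j / n) ^ 2)]
  have h4 : ∀ m ∈ Finset.range n, (∑ i ∈ Finset.Ico (m + 1) n,
      (H ((i + 1 : ℕ) / n) - H (i / n))) ^ 2 = H ((m + 1 : ℕ) / n) ^ 2 := by
    intro m hm
    rw [Finset.sum_Ico_sub (fun i : ℕ => H ((i : ℝ) / n)) (Finset.mem_range.1 hm),
      div_self hn0.ne', hH1]
    ring
  rw [Finset.sum_congr rfl h4]
  have h5 := Finset.sum_range_succ (fun j : ℕ => H ((j : ℝ) / n) ^ 2) n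
  rw [Finset.sum_range_succ', div_self hn0.ne', hH1] at h5
  simp only [Nat.cast_zero, zero_div, hH0, ne_eq, OfNat.ofNat_ne_zero, not_false_eq_true,
    zero_pow, add_zero] at h5
  rw [h5, Finset.sum_mul]
  refine Finset.sum_congr rfl fun j _ => ?_
  push_cast
  ring

theorem IsStdBM.measurable_integral_mul {W : ℝ → Ω → ℝ} (hW : IsStdBM P W) {H h : ℝ → ℝ}
    (hH : ∀ x, HasDerivAt H (h x) x) (hh : Continuous h) :
    Measurable fun ω => ∫ u in (0 : ℝ)..1, h u * W u ω := by
  refine measurable_of_tendsto_metrizable (f := fun (n : ℕ) ω => ∑ j ∈ Finset.range n,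
    (H ((j + 1 : ℕ) / n) - H (j / n)) * W (j / n) ω) (fun n => ?_) ?_
  · exact Finset.measurable_sum _ fun j _ => (hW.1 _).const_mul _
  · exact tendsto_pi_nhds.2 fun ω =>
      tendsto_sum_sub_mul ((hW.2.1 ω).mono Set.Icc_subset_Ici_self) hH hh

theorem IsStdBM.integral_exp_integral_mul_add [IsProbabilityMeasure P] {W₁ W₂ : ℝ → Ω → ℝ}
    (hW₁ : IsStdBM P W₁) (hW₂ : IsStdBM P W₂)
    (hindep : IndepFun (fun ω => fun t => W₁ t ω) (fun ω => fun t => W₂ t ω) P)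
    {H₁ h₁ H₂ h₂ : ℝ → ℝ}
    (hH₁ : ∀ x, HasDerivAt H₁ (h₁ x) x) (hh₁ : Continuous h₁) (hH₁0 : H₁ 0 = 0) (hH₁1 : H₁ 1 = 0)
    (hH₂ : ∀ x, HasDerivAt H₂ (h₂ x) x) (hh₂ : Continuous h₂) (hH₂0 : H₂ 0 = 0) (hH₂1 : H₂ 1 = 0) :
    ∫ ω, Complex.exp (((∫ u in (0 : ℝ)..1, h₁ u * W₁ u ω) + ∫ u in (0 : ℝ)..1, h₂ u * W₂ u ω : ℝ) *
        Complex.I) ∂P =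
      Complex.exp ((-((∫ u in (0 : ℝ)..1, H₁ u ^ 2) + ∫ u in (0 : ℝ)..1, H₂ u ^ 2) / 2 : ℝ)) := by
  set R : (ℝ → ℝ) → ℕ → (ℝ → ℝ) → ℝ := fun H n w => ∑ j ∈ Finset.range n,
    (H ((j + 1 : ℕ) / n) - H (j / n)) * w (j / n) with hR
  set V : (ℝ → ℝ) → ℕ → ℝ := fun H n => R id n fun u => H u ^ 2 with hV
  have hRm : ∀ H n, Measurable (R H n) := fun H n =>
    Finset.measurable_sum _ fun j _ => (measurable_pi_apply _).const_mul _
  have hm₁ : Measurable fun ω t => W₁ t ω := measurable_pi_iff.2 hW₁.1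
  have hm₂ : Measurable fun ω t => W₂ t ω := measurable_pi_iff.2 hW₂.1
  have hV0 : ∀ H n, 0 ≤ V H n := fun H n => Finset.sum_nonneg fun j _ =>
    mul_nonneg (sub_nonneg.2 (by simp only [id]; gcongr; simp)) (sq_nonneg _)
  have hVt : ∀ {H h : ℝ → ℝ}, (∀ x, HasDerivAt H (h x) x) →
      Tendsto (V H) atTop (𝓝 (∫ u in (0 : ℝ)..1, H u ^ 2)) := by
    intro H h hH
    have := tendsto_sum_sub_mul (f := fun u => H u ^ 2) (H := id) (h := fun _ => 1)
      ((continuous_iff_continuousAt.2 fun x => (hH x).continuousAt).pow 2).continuousOn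
      hasDerivAt_id continuous_const
    simp only [one_mul] at this
    exact this
  have hfin : ∀ n : ℕ, n ≠ 0 →
      ∫ ω, Complex.exp ((R H₁ n (fun t => W₁ t ω) + R H₂ n (fun t => W₂ t ω) : ℝ) * Complex.I) ∂P =
        Complex.exp ((-(V H₁ n + V H₂ n) / 2 : ℝ)) := by
    intro n hn
    have hi : IndepFun (fun ω => R H₁ n (fun t => W₁ t ω)) (fun ω => R H₂ n (fun t => W₂ t ω)) P :=
      hindep.comp (hRm H₁ n) (hRm H₂ n)
    have h1 : Measurable fun ω => R H₁ n (fun t => W₁ t ω) := (hRm H₁ n).comp hm₁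
    have h2 : Measurable fun ω => R H₂ n (fun t => W₂ t ω) := (hRm H₂ n).comp hm₂
    have hadd : Measurable fun ω => R H₁ n (fun t => W₁ t ω) + R H₂ n (fun t => W₂ t ω) :=
      h1.add h2
    have hc := congrFun (hi.charFun_map_fun_add_eq_mul h1.aemeasurable h2.aemeasurable) 1
    have g1 : P.map (fun ω => R H₁ n (fun t => W₁ t ω)) = gaussianReal 0 (V H₁ n).toNNReal :=
      hW₁.map_sum_sub_mul hH₁0 hH₁1 hn
    have g2 : P.map (fun ω => R H₂ n (fun t => W₂ t ω)) = gaussianReal 0 (V H₂ n).toNNReal :=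
      hW₂.map_sum_sub_mul hH₂0 hH₂1 hn
    rw [Pi.mul_apply, g1, g2, charFun_gaussianReal, charFun_gaussianReal, charFun_apply_real,
      integral_map hadd.aemeasurable (by fun_prop), ← Complex.exp_add] at hc
    simp only [Complex.ofReal_one, one_mul, Real.coe_toNNReal _ (hV0 _ _)] at hc
    rw [hc]
    congr 1
    push_cast
    ring
  have hlim : Tendsto (fun n => ∫ ω, Complex.exp ((R H₁ n (fun t => W₁ t ω) +
      R H₂ n (fun t => W₂ t ω) : ℝ) * Complex.I) ∂P) atTop
      (𝓝 (∫ ω, Complex.exp (((∫ u in (0 : ℝ)..1, h₁ u * W₁ u ω) +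
        ∫ u in (0 : ℝ)..1, h₂ u * W₂ u ω : ℝ) * Complex.I) ∂P)) := by
    refine tendsto_integral_of_dominated_convergence (fun _ => 1) (fun n => ?_)
      (integrable_const _) (fun n => ?_) ?_
    · refine Measurable.aestronglyMeasurable ?_
      have h1 : Measurable fun ω => R H₁ n (fun t => W₁ t ω) := (hRm H₁ n).comp hm₁
      have h2 : Measurable fun ω => R H₂ n (fun t => W₂ t ω) := (hRm H₂ n).comp hm₂
      exact Complex.measurable_exp.comp
        ((Complex.measurable_ofReal.comp (h1.add h2)).mul_const _)
    · exact ae_of_all _ fun ω => (Complex.norm_exp_ofReal_mul_I _).le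
    · refine ae_of_all _ fun ω => ?_
      have t1 := tendsto_sum_sub_mul ((hW₁.2.1 ω).mono Set.Icc_subset_Ici_self) hH₁ hh₁
      have t2 := tendsto_sum_sub_mul ((hW₂.2.1 ω).mono Set.Icc_subset_Ici_self) hH₂ hh₂
      have hcont : Continuous fun x : ℝ => Complex.exp (x * Complex.I) := by fun_prop
      exact (hcont.tendsto _).comp (t1.add t2)
  have hlim2 : Tendsto (fun n => Complex.exp ((-(V H₁ n + V H₂ n) / 2 : ℝ))) atTop
      (𝓝 (Complex.exp
        ((-((∫ u in (0 : ℝ)..1, H₁ u ^ 2) + ∫ u in (0 : ℝ)..1, H₂ u ^ 2) / 2 : ℝ)))) := by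
    have hcont : Continuous fun x : ℝ => Complex.exp ((-x / 2 : ℝ)) := by fun_prop
    exact (hcont.tendsto _).comp ((hVt hH₁).add (hVt hH₂))
  refine tendsto_nhds_unique hlim (hlim2.congr' ?_)
  filter_upwards [eventually_ne_atTop 0] with n hn using (hfin n hn).symm

theorem integral_cos_int_mul_pi {m : ℤ} (hm : m ≠ 0) :
    ∫ u in (0 : ℝ)..1, Real.cos (Real.pi * m * u) = 0 := by
  have : Real.pi * m ≠ 0 := mul_ne_zero Real.pi_ne_zero (by exact_mod_cast hm)
  rw [intervalIntegral.integral_comp_mul_left (fun x => Real.cos x) this]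
  simp [mul_comm Real.pi, Real.sin_int_mul_pi]

theorem integral_sin_mul_sin_pi (k l : ℕ) :
    ∫ u in (0 : ℝ)..1, Real.sin (Real.pi * (k + 1) * u) * Real.sin (Real.pi * (l + 1) * u) =
      if k = l then 1 / 2 else 0 := by
  have h : ∀ u : ℝ, Real.sin (Real.pi * (k + 1) * u) * Real.sin (Real.pi * (l + 1) * u) =
      1 / 2 * (Real.cos (Real.pi * ((k - l : ℤ) : ℝ) * u) -
        Real.cos (Real.pi * ((k + l + 2 : ℤ) : ℝ) * u)) := by
    intro u
    push_cast
    rw [show Real.pi * ((k : ℝ) - l) * u = Real.pi * (k + 1) * u - Real.pi * (l + 1) * u by ring,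
      show Real.pi * ((k : ℝ) + l + 2) * u = Real.pi * (k + 1) * u + Real.pi * (l + 1) * u by ring,
      Real.cos_sub, Real.cos_add]
    ring
  simp_rw [h]
  rw [intervalIntegral.integral_const_mul, intervalIntegral.integral_sub
    (Continuous.intervalIntegrable (by fun_prop) _ _)
    (Continuous.intervalIntegrable (by fun_prop) _ _),
    integral_cos_int_mul_pi (m := k + l + 2) (by lia)]
  split_ifs with hkl
  · simp [hkl]
  · rw [integral_cos_int_mul_pi (by lia)]
    simp

theorem integral_sq_sum_sin {N : ℕ} (θ : Fin N → ℝ) :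
    ∫ u in (0 : ℝ)..1, (∑ k, θ k * (Real.sin (Real.pi * (k + 1) * u) / (Real.pi * (k + 1)))) ^ 2 =
      ∑ k, θ k ^ 2 * (1 / (2 * (Real.pi * (k + 1)) ^ 2)) := by
  simp_rw [sq, Finset.sum_mul_sum]
  rw [intervalIntegral.integral_finsetSum
    fun k _ => Continuous.intervalIntegrable (by fun_prop) _ _]
  refine Finset.sum_congr rfl fun k _ => ?_
  rw [intervalIntegral.integral_finsetSum
    fun k _ => Continuous.intervalIntegrable (by fun_prop) _ _]
  have h : ∀ l : Fin N, ∫ u in (0 : ℝ)..1,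
      θ k * (Real.sin (Real.pi * (k + 1) * u) / (Real.pi * (k + 1))) *
        (θ l * (Real.sin (Real.pi * (l + 1) * u) / (Real.pi * (l + 1)))) =
      if k = l then θ k * θ k * (1 / (2 * (Real.pi * (k + 1) * (Real.pi * (k + 1))))) else 0 := by
    intro l
    have := integral_sin_mul_sin_pi k l
    rw [show (fun u : ℝ => θ k * (Real.sin (Real.pi * (k + 1) * u) / (Real.pi * (k + 1))) *
        (θ l * (Real.sin (Real.pi * (l + 1) * u) / (Real.pi * (l + 1))))) =
        fun u => θ k * θ l / (Real.pi * (k + 1) * (Real.pi * (l + 1))) *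
          (Real.sin (Real.pi * (k + 1) * u) * Real.sin (Real.pi * (l + 1) * u)) by
        ext u; field_simp,
      intervalIntegral.integral_const_mul, this]
    by_cases hkl : k = l
    · subst hkl
      simp
      field_simp
    · simp [hkl, Fin.val_inj]
  simp_rw [h]
  simp

theorem sum_mul_cosCoeff {f : ℝ → ℝ} (hf : ContinuousOn f (Set.Icc 0 1)) {N : ℕ}
    (θ : Fin N → ℝ) :
    ∑ k, θ k * cosCoeff f k =
      ∫ u in (0 : ℝ)..1, (∑ k, θ k * Real.cos (Real.pi * (k + 1) * u)) * f u := by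
  simp_rw [Finset.sum_mul]
  rw [intervalIntegral.integral_finsetSum]
  · refine Finset.sum_congr rfl fun k _ => ?_
    simp_rw [mul_assoc (θ k), intervalIntegral.integral_const_mul, cosCoeff]
  · intro k _
    refine ContinuousOn.intervalIntegrable ?_
    rw [Set.uIcc_of_le zero_le_one]
    exact ContinuousOn.mul (Continuous.continuousOn (by fun_prop)) hf

theorem hasDerivAt_sin_div (k : ℕ) (x : ℝ) :
    HasDerivAt (fun u => Real.sin (Real.pi * (k + 1) * u) / (Real.pi * (k + 1)))
      (Real.cos (Real.pi * (k + 1) * x)) x := by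
  have h : Real.pi * ((k : ℝ) + 1) ≠ 0 := by positivity
  have := ((hasDerivAt_id x).const_mul (Real.pi * ((k : ℝ) + 1))).sin.div_const
    (Real.pi * (k + 1))
  simpa [h] using this

theorem IsStdBM.measurable_cosCoeff {W : ℝ → Ω → ℝ} (hW : IsStdBM P W) (k : ℕ) :
    Measurable fun ω => cosCoeff (fun t => W t ω) k :=
  hW.measurable_integral_mul (hasDerivAt_sin_div k) (by fun_prop)

theorem IsStdBM.integral_exp_sum_cosCoeff [IsProbabilityMeasure P] {W₁ W₂ : ℝ → Ω → ℝ}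
    (hW₁ : IsStdBM P W₁) (hW₂ : IsStdBM P W₂)
    (hindep : IndepFun (fun ω => fun t => W₁ t ω) (fun ω => fun t => W₂ t ω) P)
    {N : ℕ} (θ₁ θ₂ : Fin N → ℝ) :
    ∫ ω, Complex.exp ((∑ k, θ₁ k * cosCoeff (fun t => W₁ t ω) k +
        ∑ k, θ₂ k * cosCoeff (fun t => W₂ t ω) k : ℝ) * Complex.I) ∂P =
      Complex.exp
        ((-(∑ k, (θ₁ k ^ 2 + θ₂ k ^ 2) * (1 / (2 * (Real.pi * (k + 1)) ^ 2))) / 2 : ℝ)) := by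
  have hH : ∀ (θ : Fin N → ℝ) (x : ℝ), HasDerivAt
      (fun u => ∑ k, θ k * (Real.sin (Real.pi * (k + 1) * u) / (Real.pi * (k + 1))))
      (∑ k, θ k * Real.cos (Real.pi * (k + 1) * x)) x := fun θ x =>
    HasDerivAt.fun_sum fun k _ => (hasDerivAt_sin_div k x).const_mul _
  have hz : ∀ k : Fin N, Real.sin (Real.pi * (k + 1)) = 0 := fun k => by
    simpa [mul_comm] using Real.sin_nat_mul_pi (k + 1)
  have h := hW₁.integral_exp_integral_mul_add hW₂ hindep (hH θ₁) (by fun_prop) (by simp)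
    (by simp [hz]) (hH θ₂) (by fun_prop) (by simp) (by simp [hz])
  rw [integral_sq_sum_sin, integral_sq_sum_sin, ← Finset.sum_add_distrib] at h
  simp_rw [← add_mul] at h
  rw [← h]
  refine integral_congr_ae (ae_of_all _ fun ω => ?_)
  simp only
  rw [sum_mul_cosCoeff ((hW₁.2.1 ω).mono Set.Icc_subset_Ici_self),
    sum_mul_cosCoeff ((hW₂.2.1 ω).mono Set.Icc_subset_Ici_self)]

theorem integral_exp_neg_sum_mul_sq_of_charFun [IsProbabilityMeasure P] {ι : Type*} [Fintype ι]
    {Y : ι → Ω → ℝ} (hY : ∀ i, Measurable (Y i)) (v : ι → NNReal)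
    (h : ∀ t : ι → ℝ, ∫ ω, Complex.exp ((∑ i, t i * Y i ω : ℝ) * Complex.I) ∂P =
      Complex.exp ((-(∑ i, t i ^ 2 * v i) / 2 : ℝ)))
    {b : ι → ℝ} (hb : ∀ i, 0 ≤ b i) :
    ∫ ω, Real.exp (-∑ i, b i * Y i ω ^ 2) ∂P = ∏ i, (Real.sqrt (1 + 2 * b i * v i))⁻¹ := by
  classical
  have hlaw : ∀ i, P.map (Y i) = gaussianReal 0 (v i) := by
    intro i
    have := Measure.isProbabilityMeasure_map (μ := P) (hY i).aemeasurable
    refine Measure.ext_of_charFun (funext fun t => ?_)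
    rw [charFun_gaussianReal, charFun_apply_real, integral_map (hY i).aemeasurable (by fun_prop)]
    have := h (Pi.single i t)
    simp only [Pi.single_apply, ite_mul, zero_mul, Finset.sum_ite_eq', Finset.mem_univ, if_true,
      ite_pow, ne_eq, OfNat.ofNat_ne_zero, not_false_eq_true, zero_pow] at this
    push_cast at this ⊢
    rw [this]
    congr 1
    ring
  have hind : iIndepFun Y P := by
    rw [iIndepFun_iff_charFun_pi fun i => (hY i).aemeasurable]
    intro t
    simp_rw [hlaw, charFun_gaussianReal]
    rw [charFun_apply, integral_map (by fun_prop) (by fun_prop), ← Complex.exp_sum]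
    have := h t
    simp only [PiLp.inner_apply, RCLike.inner_apply, conj_trivial]
    rw [this]
    congr 1
    push_cast
    rw [← Finset.sum_neg_distrib, Finset.sum_div]
    refine Finset.sum_congr rfl fun i _ => ?_
    ring
  simp_rw [← Finset.sum_neg_distrib, Real.exp_sum]
  rw [hind.integral_fun_prod_comp (f := fun i x => Real.exp (-(b i * x ^ 2)))
    (fun i => (hY i).aemeasurable) (fun i => by fun_prop)]
  refine Finset.prod_congr rfl fun i _ => ?_
  rw [← integral_exp_neg_mul_sq_gaussianReal (v i) (hb i), ← hlaw i,
    integral_map (hY i).aemeasurable (by fun_prop)]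
  simp_rw [neg_mul]

theorem cosCoeff_add_mul {f g : ℝ → ℝ} (hf : ContinuousOn f (Set.Icc 0 1))
    (hg : ContinuousOn g (Set.Icc 0 1)) (a b : ℝ) (k : ℕ) :
    cosCoeff (fun t => a * f t + b * g t) k = a * cosCoeff f k + b * cosCoeff g k := by
  have hi : ∀ {f : ℝ → ℝ}, ContinuousOn f (Set.Icc 0 1) → IntervalIntegrable
      (fun u => Real.cos (Real.pi * (k + 1) * u) * f u) volume 0 1 := by
    intro f hf
    refine ContinuousOn.intervalIntegrable ?_
    rw [Set.uIcc_of_le zero_le_one]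
    exact ContinuousOn.mul (Continuous.continuousOn (by fun_prop)) hf
  simp only [cosCoeff]
  rw [← intervalIntegral.integral_const_mul, ← intervalIntegral.integral_const_mul,
    ← intervalIntegral.integral_add ((hi hf).const_mul _) ((hi hg).const_mul _)]
  congr 1
  ext u
  ring

/-- The joint Laplace transform of the squared cosine coefficients of a rotated pair of
independent Brownian motions. -/
theorem IsStdBM.integral_exp_neg_sum_cosCoeff_sq [IsProbabilityMeasure P] {W₁ W₂ : ℝ → Ω → ℝ}
    (hW₁ : IsStdBM P W₁) (hW₂ : IsStdBM P W₂)
    (hindep : IndepFun (fun ω => fun t => W₁ t ω) (fun ω => fun t => W₂ t ω) P)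
    {a b : ℝ} (hab : a ^ 2 + b ^ 2 = 1) (l₁ l₂ : ℝ) (N : ℕ) :
    ∫ ω, Real.exp (-∑ k ∈ Finset.range N,
        (l₁ ^ 2 * cosCoeff (fun t => a * W₁ t ω + b * W₂ t ω) k ^ 2 +
          l₂ ^ 2 * cosCoeff (fun t => -b * W₁ t ω + a * W₂ t ω) k ^ 2)) ∂P =
      (Real.sqrt ((∏ k ∈ Finset.range N, (1 + l₁ ^ 2 / (Real.pi * (k + 1)) ^ 2)) *
        ∏ k ∈ Finset.range N, (1 + l₂ ^ 2 / (Real.pi * (k + 1)) ^ 2)))⁻¹ := by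
  have hc₁ : ∀ ω, ContinuousOn (fun t => W₁ t ω) (Set.Icc 0 1) := fun ω =>
    (hW₁.2.1 ω).mono Set.Icc_subset_Ici_self
  have hc₂ : ∀ ω, ContinuousOn (fun t => W₂ t ω) (Set.Icc 0 1) := fun ω =>
    (hW₂.2.1 ω).mono Set.Icc_subset_Ici_self
  set Y : Fin N ⊕ Fin N → Ω → ℝ := Sum.elim
    (fun k ω => cosCoeff (fun t => a * W₁ t ω + b * W₂ t ω) k)
    (fun k ω => cosCoeff (fun t => -b * W₁ t ω + a * W₂ t ω) k) with hYdef
  have hlin : ∀ (x y : ℝ) k ω, cosCoeff (fun t => x * W₁ t ω + y * W₂ t ω) k =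
      x * cosCoeff (fun t => W₁ t ω) k + y * cosCoeff (fun t => W₂ t ω) k :=
    fun x y k ω => cosCoeff_add_mul (hc₁ ω) (hc₂ ω) x y k
  have hY : ∀ i, Measurable (Y i) := by
    rintro (k | k)
    all_goals
      simp only [hYdef, Sum.elim_inl, Sum.elim_inr, hlin]
      exact ((hW₁.measurable_cosCoeff k).const_mul _).add ((hW₂.measurable_cosCoeff k).const_mul _)
  let w : Fin N → NNReal := fun k => (1 / (2 * (Real.pi * (k + 1)) ^ 2)).toNNReal
  have hw : ∀ k, (w k : ℝ) = 1 / (2 * (Real.pi * (k + 1)) ^ 2) := fun k =>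
    Real.coe_toNNReal _ (by positivity)
  have key := integral_exp_neg_sum_mul_sq_of_charFun (P := P) hY (Sum.elim w w)
    (b := Sum.elim (fun _ => l₁ ^ 2) (fun _ => l₂ ^ 2)) ?_ ?_
  · simp only [Fintype.sum_sum_type, Fintype.prod_sum_type, Sum.elim_inl, Sum.elim_inr, hYdef, hw]
      at key
    simp only [Finset.sum_add_distrib, Finset.sum_range, Finset.prod_range]
    rw [key, Real.sqrt_mul (Finset.prod_nonneg fun k _ => by positivity),
      Real.sqrt_prod _ fun k _ => by positivity, Real.sqrt_prod _ fun k _ => by positivity,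
      mul_inv, Finset.prod_inv_distrib, Finset.prod_inv_distrib]
    congr 4 <;> ext k <;> congr 2 <;> field_simp
  · intro t
    have h := hW₁.integral_exp_sum_cosCoeff hW₂ hindep
      (fun k => a * t (.inl k) - b * t (.inr k)) (fun k => b * t (.inl k) + a * t (.inr k))
    simp only [Fintype.sum_sum_type, Sum.elim_inl, Sum.elim_inr, hYdef, hw, hlin]
    refine (integral_congr_ae (ae_of_all _ fun ω => ?_)).trans (h.trans ?_)
    · simp only [← Finset.sum_add_distrib]
      congr 3
      refine Finset.sum_congr rfl fun k _ => ?_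
      ring
    · simp only [← Finset.sum_add_distrib]
      congr 4
      refine Finset.sum_congr rfl fun k _ => ?_
      linear_combination ((t (.inl k) ^ 2 + t (.inr k) ^ 2) *
        (1 / (2 * (Real.pi * (k + 1)) ^ 2))) * hab
  · rintro (k | k) <;> simp [sq_nonneg]

theorem IsStdBM.integral_exp_centered [IsProbabilityMeasure P] {W₁ W₂ : ℝ → Ω → ℝ}
    (hW₁ : IsStdBM P W₁) (hW₂ : IsStdBM P W₂)
    (hindep : IndepFun (fun ω => fun t => W₁ t ω) (fun ω => fun t => W₂ t ω) P)
    {a b : ℝ} (hab : a ^ 2 + b ^ 2 = 1) {l₁ l₂ : ℝ} (hl₁ : 0 < l₁) (hl₂ : 0 < l₂) :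
    ∫ ω, Real.exp (-(1 / 2) *
        (l₁ ^ 2 * (∫ u in (0 : ℝ)..1, (a * W₁ u ω + b * W₂ u ω -
          ∫ v in (0 : ℝ)..1, (a * W₁ v ω + b * W₂ v ω)) ^ 2) +
        l₂ ^ 2 * ∫ u in (0 : ℝ)..1, (-b * W₁ u ω + a * W₂ u ω -
          ∫ v in (0 : ℝ)..1, (-b * W₁ v ω + a * W₂ v ω)) ^ 2)) ∂P =
      Real.sqrt (l₁ * l₂ / (Real.sinh l₁ * Real.sinh l₂)) := by
  have hc₁ : ∀ ω, ContinuousOn (fun t => W₁ t ω) (Set.Icc 0 1) := fun ω =>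
    (hW₁.2.1 ω).mono Set.Icc_subset_Ici_self
  have hc₂ : ∀ ω, ContinuousOn (fun t => W₂ t ω) (Set.Icc 0 1) := fun ω =>
    (hW₂.2.1 ω).mono Set.Icc_subset_Ici_self
  have hc : ∀ (x y : ℝ) ω, ContinuousOn (fun t => x * W₁ t ω + y * W₂ t ω) (Set.Icc 0 1) :=
    fun x y ω => ((hc₁ ω).const_smul x).add ((hc₂ ω).const_smul y)
  have hm : ∀ (x y : ℝ) k, Measurable fun ω => cosCoeff (fun t => x * W₁ t ω + y * W₂ t ω) k := by
    intro x y k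
    simp only [cosCoeff_add_mul (hc₁ _) (hc₂ _)]
    exact ((hW₁.measurable_cosCoeff k).const_mul _).add ((hW₂.measurable_cosCoeff k).const_mul _)
  have hlim := tendsto_integral_of_dominated_convergence (μ := P) (fun _ => (1 : ℝ))
    (F := fun N ω => Real.exp (-∑ k ∈ Finset.range N,
        (l₁ ^ 2 * cosCoeff (fun t => a * W₁ t ω + b * W₂ t ω) k ^ 2 +
          l₂ ^ 2 * cosCoeff (fun t => -b * W₁ t ω + a * W₂ t ω) k ^ 2)))
    (f := fun ω => Real.exp (-(1 / 2) *
        (l₁ ^ 2 * (∫ u in (0 : ℝ)..1, (a * W₁ u ω + b * W₂ u ω -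
          ∫ v in (0 : ℝ)..1, (a * W₁ v ω + b * W₂ v ω)) ^ 2) +
        l₂ ^ 2 * ∫ u in (0 : ℝ)..1, (-b * W₁ u ω + a * W₂ u ω -
          ∫ v in (0 : ℝ)..1, (-b * W₁ v ω + a * W₂ v ω)) ^ 2)))
    (fun N => ?_) (integrable_const _) (fun N => ae_of_all _ fun ω => ?_)
    (ae_of_all _ fun ω => ?_)
  · simp_rw [hW₁.integral_exp_neg_sum_cosCoeff_sq hW₂ hindep hab] at hlim
    have hs₁ := Real.sinh_pos_iff.2 hl₁
    have hs₂ := Real.sinh_pos_iff.2 hl₂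
    refine tendsto_nhds_unique hlim ?_
    rw [show l₁ * l₂ / (Real.sinh l₁ * Real.sinh l₂) =
      (Real.sinh l₁ / l₁ * (Real.sinh l₂ / l₂))⁻¹ by field_simp, Real.sqrt_inv]
    exact (((tendsto_prod_one_add_sq_div hl₁.ne').mul
      (tendsto_prod_one_add_sq_div hl₂.ne')).sqrt).inv₀ (by positivity)
  · refine (Real.measurable_exp.comp (Measurable.neg ?_)).aestronglyMeasurable
    exact Finset.measurable_sum _ fun k _ =>
      (((hm a b k).pow_const 2).const_mul _).add (((hm (-b) a k).pow_const 2).const_mul _)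
  · rw [Real.norm_eq_abs, Real.abs_exp, Real.exp_le_one_iff, neg_nonpos]
    exact Finset.sum_nonneg fun k _ => by positivity
  · refine (Real.continuous_exp.tendsto _).comp ?_
    have h := (((hasSum_cosCoeff (hc a b ω)).mul_left (l₁ ^ 2)).add
      ((hasSum_cosCoeff (hc (-b) a ω)).mul_left (l₂ ^ 2))).tendsto_sum_nat.const_mul (-(1 / 2))
    refine h.congr fun N => ?_
    rw [Finset.mul_sum, ← Finset.sum_neg_distrib]
    refine Finset.sum_congr rfl fun k _ => ?_
    ring

theorem exists_rotation_diagonalizing {p q r μ₁ μ₂ : ℝ} (htr : p + r = μ₁ + μ₂)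
    (hdet : p * r - q ^ 2 = μ₁ * μ₂) (hle : μ₂ ≤ μ₁) :
    ∃ a b : ℝ, a ^ 2 + b ^ 2 = 1 ∧ p = a ^ 2 * μ₁ + b ^ 2 * μ₂ ∧ q = a * b * (μ₁ - μ₂) ∧
      r = b ^ 2 * μ₁ + a ^ 2 * μ₂ := by
  set z : ℂ := ⟨p - r, 2 * q⟩ with hz
  have hnorm : ‖z‖ = μ₁ - μ₂ := by
    rw [← Real.sqrt_sq (sub_nonneg.2 hle), Complex.norm_def, Complex.normSq_apply]
    congr 1
    simp only [hz]
    linear_combination (p + r + μ₁ + μ₂) * htr - 4 * hdet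
  have hcos : (μ₁ - μ₂) * Real.cos z.arg = p - r := by
    rw [← hnorm, Complex.norm_mul_cos_arg]
  have hsin : (μ₁ - μ₂) * Real.sin z.arg = 2 * q := by
    rw [← hnorm, Complex.norm_mul_sin_arg]
  have harg : z.arg = 2 * (z.arg / 2) := by ring
  have hone := Real.cos_sq_add_sin_sq (z.arg / 2)
  rw [harg, Real.cos_two_mul] at hcos
  rw [harg, Real.sin_two_mul] at hsin
  refine ⟨Real.cos (z.arg / 2), Real.sin (z.arg / 2), hone, ?_, ?_, ?_⟩
  · linear_combination (1 / 2) * htr - (1 / 2) * hcos - μ₂ * hone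
  · linear_combination -(1 / 2) * hsin
  · linear_combination (1 / 2) * htr + (1 / 2) * hcos - μ₁ * hone

end BrownianMotion

theorem stmt_10 {Ω : Type*} [MeasurableSpace Ω] (P : Measure Ω) [IsProbabilityMeasure P]
    (W₁ W₂ : ℝ → Ω → ℝ) (hW₁ : IsStdBM P W₁) (hW₂ : IsStdBM P W₂)
    (hindep : IndepFun (fun ω => fun t => W₁ t ω) (fun ω => fun t => W₂ t ω) P)
    (c : ℝ) (hc : c ∈ Set.Ioo (-1 : ℝ) 1)
    (X₁ X₂ : ℝ → Ω → ℝ)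
    (hX₁ : ∀ t ω, X₁ t ω = W₁ t ω)
    (hX₂ : ∀ t ω, X₂ t ω = c * W₁ t ω + Real.sqrt (1 - c ^ 2) * W₂ t ω)
    (S : Matrix (Fin 2) (Fin 2) ℝ) (hSsymm : S.IsSymm) (hSpsd : S.PosSemidef)
    (lam₁ lam₂ : ℝ) (hlam₁pos : 0 < lam₁) (hlam₂pos : 0 < lam₂)
    (hlam₁ : lam₁ ^ 2 = (1 / 2) * (S 0 0 + S 1 1 + 2 * c * S 0 1 +
      Real.sqrt ((S 0 0 - S 1 1) ^ 2 + 4 * (c * S 0 0 + S 0 1) * (c * S 1 1 + S 0 1))))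
    (hlam₂ : lam₂ ^ 2 = (1 / 2) * (S 0 0 + S 1 1 + 2 * c * S 0 1 -
      Real.sqrt ((S 0 0 - S 1 1) ^ 2 + 4 * (c * S 0 0 + S 0 1) * (c * S 1 1 + S 0 1)))) :
    ∫ ω, Real.exp (-(1 / 2) * ∫ u in (0:ℝ)..1,
        (fun i => ![X₁ u ω, X₂ u ω] i - ∫ v in (0:ℝ)..1, ![X₁ v ω, X₂ v ω] i) ⬝ᵥ
          S.mulVec
            (fun i => ![X₁ u ω, X₂ u ω] i - ∫ v in (0:ℝ)..1, ![X₁ v ω, X₂ v ω] i)) ∂P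
      = Real.sqrt (lam₁ * lam₂ / (Real.sinh lam₁ * Real.sinh lam₂)) := by
  have hsym : S 1 0 = S 0 1 := hSsymm.apply 0 1
  have hs : Real.sqrt (1 - c ^ 2) ^ 2 = 1 - c ^ 2 :=
    Real.sq_sqrt (by nlinarith [hc.1, hc.2])
  set s := Real.sqrt (1 - c ^ 2) with hsdef
  set p := S 0 0 + 2 * c * S 0 1 + c ^ 2 * S 1 1 with hp
  set q := s * (S 0 1 + c * S 1 1) with hq
  set r := s ^ 2 * S 1 1 with hr
  have hdisc : (S 0 0 - S 1 1) ^ 2 + 4 * (c * S 0 0 + S 0 1) * (c * S 1 1 + S 0 1) =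
      (p - r) ^ 2 + (2 * q) ^ 2 := by
    simp only [hp, hq, hr, mul_pow, hs]
    ring
  rw [hdisc] at hlam₁ hlam₂
  have hsq := Real.sq_sqrt (show 0 ≤ (p - r) ^ 2 + (2 * q) ^ 2 by positivity)
  set d := Real.sqrt ((p - r) ^ 2 + (2 * q) ^ 2) with hd
  have hd0 : 0 ≤ d := Real.sqrt_nonneg _
  have htr' : S 0 0 + S 1 1 + 2 * c * S 0 1 = p + r := by
    simp only [hp, hr, hs]
    ring
  rw [htr'] at hlam₁ hlam₂
  obtain ⟨a, b, hab, hpa, hqa, hra⟩ := exists_rotation_diagonalizing (p := p) (q := q) (r := r)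
    (μ₁ := lam₁ ^ 2) (μ₂ := lam₂ ^ 2) (by rw [hlam₁, hlam₂]; ring)
    (by rw [hlam₁, hlam₂]; linear_combination (1 / 4) * hsq) (by rw [hlam₁, hlam₂]; linarith)
  rw [← hW₁.integral_exp_centered hW₂ hindep hab hlam₁pos hlam₂pos]
  refine integral_congr_ae (ae_of_all _ fun ω => ?_)
  simp only
  congr 2
  have hc₁ : ContinuousOn (fun t => W₁ t ω) (Set.uIcc 0 1) :=
    (hW₁.2.1 ω).mono (by rw [Set.uIcc_of_le zero_le_one]; exact Set.Icc_subset_Ici_self)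
  have hc₂ : ContinuousOn (fun t => W₂ t ω) (Set.uIcc 0 1) :=
    (hW₂.2.1 ω).mono (by rw [Set.uIcc_of_le zero_le_one]; exact Set.Icc_subset_Ici_self)
  have hlin : ∀ x y : ℝ, ∫ v in (0 : ℝ)..1, (x * W₁ v ω + y * W₂ v ω) =
      x * (∫ v in (0 : ℝ)..1, W₁ v ω) + y * ∫ v in (0 : ℝ)..1, W₂ v ω := by
    intro x y
    rw [intervalIntegral.integral_add (hc₁.intervalIntegrable.const_mul x)
      (hc₂.intervalIntegrable.const_mul y), intervalIntegral.integral_const_mul,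
      intervalIntegral.integral_const_mul]
  have hsqint : ∀ x y m : ℝ, IntervalIntegrable
      (fun u => (x * W₁ u ω + y * W₂ u ω - m) ^ 2) volume 0 1 := fun x y m =>
    ((((hc₁.const_smul x).add (hc₂.const_smul y)).sub
      continuousOn_const).pow 2).intervalIntegrable
  rw [← intervalIntegral.integral_const_mul, ← intervalIntegral.integral_const_mul,
    ← intervalIntegral.integral_add ((hsqint _ _ _).const_mul _) ((hsqint _ _ _).const_mul _)]
  refine intervalIntegral.integral_congr fun u _ => ?_
  simp only [dotProduct, mulVec, Fin.sum_univ_two, Matrix.cons_val_zero, Matrix.cons_val_one,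
    hX₁, hX₂, hlin, hsym]
  generalize (∫ v in (0 : ℝ)..1, W₁ v ω) = m₁
  generalize (∫ v in (0 : ℝ)..1, W₂ v ω) = m₂
  linear_combination (W₁ u ω - m₁) ^ 2 * hpa + 2 * (W₁ u ω - m₁) * (W₂ u ω - m₂) * hqa +
    (W₂ u ω - m₂) ^ 2 * hra
end
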